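/- arXiv:2108.11639 — 2 statements merged into one kernel-verified Lean document; each statement's English description precedes it below -/
import Mathlib

section
/- Let $n \ge 1$ and let $(M, g, \varphi, \xi, \eta)$ be a (non-empty) $(2n+1)$-dimensional Kenmotsu manifold, that is, a smooth Riemannian manifold $(M,g)$ with a smooth $(1,1)$-tensor field $\varphi$, a smooth vector field $\xi$ and a smooth $1$-form $\eta$ such that $$\varphi^2 = -I + \eta\otimes\xi,\quad \eta(\xi)=1,\quad \eta(X)=g(X,\xi),\quad g(\varphi X,\varphi Y)=g(X,Y)-\eta(X)\eta(Y),$$ and whose Levi-Civita connection $\nabla$ satisfies $(\nabla_X\varphi)Y = g(\varphi X,Y)\xi-\eta(Y)\varphi X$ for all smooth vector fields $X,Y$. Let $S$ be the Ricci tensor of $g$, let $V$ be a smooth vector field on $M$ and let $\lambda,\mu,p$ be real constants such that $(g,V,\lambda,\mu)$ is a conformal $\eta$-Ricci soliton with conformal pressure $p$, i.e. $$\mathcal L_V g + 2S + \Big[2\lambda - \Big(p+\frac{2}{2n+1}\Big)\Big]g + 2\mu\,\eta\otimes\eta = 0 .$$ Then $$\lambda+\mu = 2n+\Big(\frac p2+\frac1{2n+1}\Big);$$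 consequently the soliton is shrinking ($\lambda>0$) if $\mu<2n+(\frac p2+\frac1{2n+1})$, steady ($\lambda=0$) if $\mu=2n+(\frac p2+\frac1{2n+1})$, and expanding ($\lambda<0$) if $\mu>2n+(\frac p2+\frac1{2n+1})$. -/
open Bundle VectorField
open scoped Manifold ContDiff

noncomputable section

namespace RiemannianGeometry

set_option linter.unusedSectionVars false

variable {E : Type*} [NormedAddCommGroup E] [NormedSpace ℝ E] [FiniteDimensional ℝ E]
  {H : Type*} [TopologicalSpace H] {I : ModelWithCorners ℝ E H}
  {M : Type*} [TopologicalSpace M] [ChartedSpace H M] [IsManifold I ∞ M]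
  [RiemannianBundle (fun x : M ↦ TangentSpace I x)]
  [IsContMDiffRiemannianBundle I ∞ E (fun x : M ↦ TangentSpace I x)]

/-- The right-hand side of the Koszul formula,
`½ (X g(Y,Z) + Y g(Z,X) - Z g(X,Y) + g([X,Y],Z) - g([X,Z],Y) - g([Y,Z],X))`;
`mvfderiv I f x (X x)` is the derivative `(X f)(x)`. -/
def koszul (X Y Z : Π x : M, TangentSpace I x) (x : M) : ℝ :=
  (1 / 2 : ℝ) *
    (mvfderiv I (fun y ↦ inner ℝ (Y y) (Z y)) x (X x)
      + mvfderiv I (fun y ↦ inner ℝ (Z y) (X y)) x (Y x)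
      - mvfderiv I (fun y ↦ inner ℝ (X y) (Y y)) x (Z x)
      + inner ℝ (mlieBracket I X Y x) (Z x)
      - inner ℝ (mlieBracket I X Z x) (Y x)
      - inner ℝ (mlieBracket I Y Z x) (X x))

lemma mdifferentiableAt_inner {X Y : Π x : M, TangentSpace I x} {x : M}
    (hX : MDiffAt (T% X) x) (hY : MDiffAt (T% Y) x) :
    MDiffAt (fun y ↦ inner ℝ (X y) (Y y)) x :=
  MDifferentiableAt.inner_bundle (IB := I) (F := E) (E := fun x : M ↦ TangentSpace I x) hX hY

lemma koszul_tensorialAt_right {X Y : Π x : M, TangentSpace I x} {x : M}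
    (hX : MDiffAt (T% X) x) (hY : MDiffAt (T% Y) x) :
    TensorialAt I E (fun Z ↦ koszul X Y Z x) x where
  smul {f Z} hf hZ := by
    have h1 := mvfderiv_fun_mul hf (mdifferentiableAt_inner hY hZ)
    have h2 := mvfderiv_fun_mul hf (mdifferentiableAt_inner hZ hX)
    simp [koszul, inner_smul_left, inner_smul_right, h1, h2, mlieBracket_smul_right hf hZ,
      inner_add_left]
    simp only [real_inner_comm]
    ring
  add {Z Z'} hZ hZ' := by
    have h1 := mvfderiv_fun_add (mdifferentiableAt_inner hY hZ) (mdifferentiableAt_inner hY hZ')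
    have h2 := mvfderiv_fun_add (mdifferentiableAt_inner hZ hX) (mdifferentiableAt_inner hZ' hX)
    simp [koszul, inner_add_left, inner_add_right, h1, h2, mlieBracket_add_right hZ hZ']
    ring

lemma koszul_tensorialAt_left {Y Z : Π x : M, TangentSpace I x} {x : M}
    (hY : MDiffAt (T% Y) x) (hZ : MDiffAt (T% Z) x) :
    TensorialAt I E (fun X ↦ koszul X Y Z x) x where
  smul {f X} hf hX := by
    have h1 := mvfderiv_fun_mul hf (mdifferentiableAt_inner hZ hX)
    have h2 := mvfderiv_fun_mul hf (mdifferentiableAt_inner hX hY)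
    simp [koszul, inner_smul_left, inner_smul_right, h1, h2, mlieBracket_smul_left hf hX,
      inner_add_left]
    simp only [real_inner_comm]
    ring
  add {X X'} hX hX' := by
    have h1 := mvfderiv_fun_add (mdifferentiableAt_inner hZ hX) (mdifferentiableAt_inner hZ hX')
    have h2 := mvfderiv_fun_add (mdifferentiableAt_inner hX hY) (mdifferentiableAt_inner hX' hY)
    simp [koszul, inner_add_left, inner_add_right, h1, h2, mlieBracket_add_left hX hX']
    ring

lemma koszul_add_mid {X Y Y' Z : Π x : M, TangentSpace I x} {x : M}
    (hX : MDiffAt (T% X) x) (hY : MDiffAt (T% Y) x) (hY' : MDiffAt (T% Y') x)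
    (hZ : MDiffAt (T% Z) x) :
    koszul X (Y + Y') Z x = koszul X Y Z x + koszul X Y' Z x := by
  have h1 := mvfderiv_fun_add (mdifferentiableAt_inner hY hZ) (mdifferentiableAt_inner hY' hZ)
  have h2 := mvfderiv_fun_add (mdifferentiableAt_inner hX hY) (mdifferentiableAt_inner hX hY')
  simp [koszul, inner_add_left, inner_add_right, h1, h2, mlieBracket_add_left hY hY',
    mlieBracket_add_right hY hY']
  ring

lemma koszul_smul_mid {f : M → ℝ} {X Y Z : Π x : M, TangentSpace I x} {x : M}
    (hf : MDiffAt f x)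
    (hX : MDiffAt (T% X) x) (hY : MDiffAt (T% Y) x) (hZ : MDiffAt (T% Z) x) :
    koszul X (f • Y) Z x =
      f x * koszul X Y Z x + mvfderiv I f x (X x) * inner ℝ (Y x) (Z x) := by
  have h1 := mvfderiv_fun_mul hf (mdifferentiableAt_inner hY hZ)
  have h2 := mvfderiv_fun_mul hf (mdifferentiableAt_inner hX hY)
  simp [koszul, inner_smul_left, inner_smul_right, h1, h2, mlieBracket_smul_left hf hY,
      mlieBracket_smul_right hf hY, inner_add_left]
  simp only [real_inner_comm]
  ring


instance finiteDimensional_tangentSpace (x : M) : FiniteDimensional ℝ (TangentSpace I x) :=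
  inferInstanceAs (FiniteDimensional ℝ E)

open scoped Classical in
/-- `∇Y` at `x`: the endomorphism `u ↦ ∑ᵢ K(u, Y, bᵢ) bᵢ` of the tangent space, where `K` is the
Koszul expression and `b` an orthonormal basis, so that `g(∇_X Y, Z) = K(X, Y, Z)`
(`inner_leviCivita`); value `0` where `Y` is not differentiable. -/
def leviCivitaAux (Y : Π x : M, TangentSpace I x) (x : M) :
    TangentSpace I x →L[ℝ] TangentSpace I x :=
  if hY : MDiffAt (T% Y) x then
    ∑ i, (TensorialAt.mkHom
      (fun X ↦ koszul X Y (FiberBundle.extend E (stdOrthonormalBasis ℝ (TangentSpace I x) i)) x) x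
      (koszul_tensorialAt_left hY (FiberBundle.mdifferentiableAt_extend ..))).smulRight
        (stdOrthonormalBasis ℝ (TangentSpace I x) i)
  else 0

lemma inner_leviCivitaAux {X Y Z : Π x : M, TangentSpace I x} {x : M}
    (hX : MDiffAt (T% X) x) (hY : MDiffAt (T% Y) x) (hZ : MDiffAt (T% Z) x) :
    inner ℝ (leviCivitaAux Y x (X x)) (Z x) = koszul X Y Z x := by
  have key := TensorialAt.mkHom_apply (koszul_tensorialAt_right hX hY) hZ
  rw [leviCivitaAux, dif_pos hY, ← key]
  conv_rhs => rw [← (stdOrthonormalBasis ℝ (TangentSpace I x)).sum_repr (Z x)]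
  rw [map_sum, _root_.sum_apply, sum_inner]
  refine Finset.sum_congr rfl fun i _ ↦ ?_
  rw [map_smul, TensorialAt.mkHom_apply_eq_extend, ContinuousLinearMap.smulRight_apply,
    TensorialAt.mkHom_apply _ hX, OrthonormalBasis.repr_apply_apply, real_inner_smul_left,
    smul_eq_mul, mul_comm]

lemma leviCivitaAux_ext {x : M} {A B : TangentSpace I x →L[ℝ] TangentSpace I x}
    (h : ∀ X Z : Π x : M, TangentSpace I x, MDiffAt (T% X) x → MDiffAt (T% Z) x →
      inner ℝ (A (X x)) (Z x) = inner ℝ (B (X x)) (Z x)) : A = B := by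
  ext u
  refine ext_inner_right ℝ fun v ↦ ?_
  simpa using h (FiberBundle.extend E u) (FiberBundle.extend E v)
    (FiberBundle.mdifferentiableAt_extend ..) (FiberBundle.mdifferentiableAt_extend ..)

variable (I M) in
/-- The Levi-Civita connection of the Riemannian metric, given by the Koszul formula. It is
torsion-free (`leviCivita_torsion`) and metric (`leviCivita_metric`).
The argument order is Mathlib's: `leviCivita I M Y x (X x)` is `(∇_X Y)(x)`. -/
def leviCivita : CovariantDerivative I E (fun x : M ↦ TangentSpace I x) where
  toFun := leviCivitaAux
  isCovariantDerivativeOnUniv := {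
    add := by
      intro Y Y' x hY hY' _
      refine leviCivitaAux_ext fun X Z hX hZ ↦ ?_
      rw [inner_leviCivitaAux hX (mdifferentiableAt_add_section hY hY') hZ,
        koszul_add_mid hX hY hY' hZ, _root_.add_apply, inner_add_left,
        inner_leviCivitaAux hX hY hZ, inner_leviCivitaAux hX hY' hZ]
    leibniz := by
      intro Y f x hY hf _
      refine leviCivitaAux_ext fun X Z hX hZ ↦ ?_
      rw [inner_leviCivitaAux hX (hf.smul_section hY) hZ, koszul_smul_mid hf hX hY hZ]
      simp [inner_add_left, inner_smul_left, inner_leviCivitaAux hX hY hZ] }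

lemma inner_leviCivita {X Y Z : Π x : M, TangentSpace I x} {x : M}
    (hX : MDiffAt (T% X) x) (hY : MDiffAt (T% Y) x) (hZ : MDiffAt (T% Z) x) :
    inner ℝ (leviCivita I M Y x (X x)) (Z x) = koszul X Y Z x :=
  inner_leviCivitaAux hX hY hZ

theorem leviCivita_torsion : (leviCivita I M).torsion = 0 := by
  rw [CovariantDerivative.torsion_eq_zero_iff]
  intro X Y x hX hY
  refine ext_inner_right ℝ fun v ↦ ?_
  have hZ : MDiffAt (T% (FiberBundle.extend E v)) x := FiberBundle.mdifferentiableAt_extend ..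
  have h1 := inner_leviCivita hX hY hZ
  have h2 := inner_leviCivita hY hX hZ
  simp only [FiberBundle.extend_apply_self] at h1 h2
  rw [inner_sub_left, h1, h2]
  simp only [koszul, FiberBundle.extend_apply_self, mlieBracket_swap_apply (V := Y) (W := X),
    inner_neg_left, real_inner_comm]
  ring

theorem leviCivita_metric {X Y Z : Π x : M, TangentSpace I x} {x : M}
    (hX : MDiffAt (T% X) x) (hY : MDiffAt (T% Y) x) (hZ : MDiffAt (T% Z) x) :
    mvfderiv I (fun y ↦ inner ℝ (Y y) (Z y)) x (X x) =
      inner ℝ (leviCivita I M Y x (X x)) (Z x) + inner ℝ (Y x) (leviCivita I M Z x (X x)) := by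
  rw [real_inner_comm _ (Y x), inner_leviCivita hX hY hZ, inner_leviCivita hX hZ hY]
  simp only [koszul, mlieBracket_swap_apply (V := Z) (W := Y),
    inner_neg_left, real_inner_comm]
  ring

/-- The vector field `∇_X Y`. -/
def nabla (X Y : Π x : M, TangentSpace I x) : Π x : M, TangentSpace I x :=
  fun x ↦ leviCivita I M Y x (X x)

/-- The curvature `R(X,Y)Z = ∇_X ∇_Y Z - ∇_Y ∇_X Z - ∇_[X,Y] Z`. -/
def curvature (X Y Z : Π x : M, TangentSpace I x) : Π x : M, TangentSpace I x :=
  fun x ↦ nabla X (nabla Y Z) x - nabla Y (nabla X Z) x - nabla (mlieBracket I X Y) Z x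

/-- The Ricci tensor `S(Y,Z) = trace (U ↦ R(U,Y)Z) = ∑ᵢ g(R(eᵢ,Y)Z, eᵢ)` at `x`, with `(eᵢ)` an
orthonormal basis of the tangent space at `x`, each `eᵢ` being extended to a vector field that is
smooth near `x`. -/
def ricci (Y Z : Π x : M, TangentSpace I x) (x : M) : ℝ :=
  ∑ i, inner ℝ
    (curvature (FiberBundle.extend E (stdOrthonormalBasis ℝ (TangentSpace I x) i)) Y Z x)
    (stdOrthonormalBasis ℝ (TangentSpace I x) i)

/-- The Lie derivative of the metric,
`(L_V g)(X,Y) = V g(X,Y) - g([V,X],Y) - g(X,[V,Y])`. -/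
def lieDerivMetric (V X Y : Π x : M, TangentSpace I x) (x : M) : ℝ :=
  mvfderiv I (fun y ↦ inner ℝ (X y) (Y y)) x (V x)
    - inner ℝ (mlieBracket I V X x) (Y x) - inner ℝ (X x) (mlieBracket I V Y x)

/-- `(φ, ξ, η)` is an almost contact metric structure on the Riemannian manifold `M`: smooth tensor
fields of types `(1,1)`, `(1,0)`, `(0,1)` with `φ² = -I + η ⊗ ξ`, `η(ξ) = 1`, `η(X) = g(X,ξ)` and
`g(φX,φY) = g(X,Y) - η(X)η(Y)`. -/
structure IsAlmostContactMetric (φ : Π x : M, TangentSpace I x →L[ℝ] TangentSpace I x)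
    (ξ : Π x : M, TangentSpace I x) (η : Π x : M, TangentSpace I x →L[ℝ] ℝ) : Prop where
  phi_smooth : ContMDiff I (I.prod 𝓘(ℝ, E →L[ℝ] E)) ∞
    (fun x ↦ TotalSpace.mk' (E →L[ℝ] E)
      (E := fun x : M ↦ TangentSpace I x →L[ℝ] TangentSpace I x) x (φ x))
  xi_smooth : CMDiff ∞ (T% ξ)
  eta_smooth : ContMDiff I (I.prod 𝓘(ℝ, E →L[ℝ] ℝ)) ∞
    (fun x ↦ TotalSpace.mk' (E →L[ℝ] ℝ) (E := fun x : M ↦ TangentSpace I x →L[ℝ] ℝ) x (η x))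
  phi_sq : ∀ (x : M) (v : TangentSpace I x), φ x (φ x v) = -v + η x v • ξ x
  eta_xi : ∀ x : M, η x (ξ x) = 1
  eta_eq : ∀ (x : M) (v : TangentSpace I x), η x v = inner ℝ v (ξ x)
  inner_phi : ∀ (x : M) (v w : TangentSpace I x),
    inner ℝ (φ x v) (φ x w) = inner ℝ v w - η x v * η x w

/-- `(M, g, φ, ξ, η)` is a Kenmotsu manifold: an almost contact metric manifold with
`(∇_X φ)Y = g(φX,Y)ξ - η(Y)φX` for all smooth vector fields `X`, `Y`, where
`(∇_X φ)Y = ∇_X (φY) - φ(∇_X Y)`. -/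
structure IsKenmotsu (φ : Π x : M, TangentSpace I x →L[ℝ] TangentSpace I x)
    (ξ : Π x : M, TangentSpace I x) (η : Π x : M, TangentSpace I x →L[ℝ] ℝ) : Prop
    extends IsAlmostContactMetric φ ξ η where
  nabla_phi : ∀ X Y : Π x : M, TangentSpace I x, CMDiff ∞ (T% X) → CMDiff ∞ (T% Y) → ∀ x : M,
    nabla X (fun y ↦ φ y (Y y)) x - φ x (nabla X Y x)
      = (inner ℝ (φ x (X x)) (Y x) : ℝ) • ξ x - η x (Y x) • φ x (X x)

/-- `(g, V, lam, mu)` is a conformal `η`-Ricci soliton with conformal pressure `p`: `V` is a smooth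
vector field and `L_V g + 2S + [2 lam - (p + 2 / dim M)] g + 2 mu η ⊗ η = 0`. -/
structure IsConformalEtaRicciSoliton (η : Π x : M, TangentSpace I x →L[ℝ] ℝ)
    (V : Π x : M, TangentSpace I x) (lam mu p : ℝ) : Prop where
  smooth : CMDiff ∞ (T% V)
  equation : ∀ X Y : Π x : M, TangentSpace I x, CMDiff ∞ (T% X) → CMDiff ∞ (T% Y) → ∀ x : M,
    lieDerivMetric V X Y x + 2 * ricci X Y x
      + (2 * lam - (p + 2 / (Module.finrank ℝ E : ℝ))) * inner ℝ (X x) (Y x)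
      + 2 * mu * (η x (X x) * η x (Y x)) = 0

end RiemannianGeometry

end

/-- An algebraic Riemannian manifold: a module of vector fields over a ring of functions, with
an action by derivations, a nondegenerate metric and its Levi-Civita connection. -/
structure LeviCivitaModule (A 𝔛 : Type*) [CommRing A] [Algebra ℝ A] [AddCommGroup 𝔛]
    [Module A 𝔛] where
  /-- The derivative of a function along a vector field. -/
  der : 𝔛 →ₗ[A] Derivation ℝ A A
  /-- The metric. -/
  metric : 𝔛 →ₗ[A] 𝔛 →ₗ[A] A
  /-- The connection, `conn X Y` being `∇_X Y`. -/
  conn : 𝔛 →ₗ[A] 𝔛 →+ 𝔛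
  metric_comm : ∀ X Y, metric X Y = metric Y X
  eq_of_metric : ∀ X Y, (∀ Z, metric X Z = metric Y Z) → X = Y
  conn_leibniz : ∀ X (f : A) Y, conn X (f • Y) = f • conn X Y + der X f • Y
  der_metric : ∀ X Y Z, der X (metric Y Z) = metric (conn X Y) Z + metric Y (conn X Z)
  der_commutator : ∀ X Y f, der (conn X Y - conn Y X) f = der X (der Y f) - der Y (der X f)
  jacobi : ∀ X Y Z, conn X (conn Y Z - conn Z Y) - conn (conn Y Z - conn Z Y) X
    = conn (conn X Y - conn Y X) Z - conn Z (conn X Y - conn Y X)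
      + (conn Y (conn X Z - conn Z X) - conn (conn X Z - conn Z X) Y)

namespace LeviCivitaModule

variable {A 𝔛 : Type*} [CommRing A] [Algebra ℝ A] [AddCommGroup 𝔛] [Module A 𝔛]
  (L : LeviCivitaModule A 𝔛)

/-- The Lie bracket `[X, Y] = ∇_X Y - ∇_Y X`. -/
def bracket (X Y : 𝔛) : 𝔛 := L.conn X Y - L.conn Y X

/-- The Lie derivative of a bilinear form along a vector field. -/
def lie (X : 𝔛) (T : 𝔛 → 𝔛 → A) (Y Z : 𝔛) : A :=
  L.der X (T Y Z) - T (L.bracket X Y) Z - T Y (L.bracket X Z)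

/-- The curvature `R(X,Y)Z`. -/
def curv (X Y Z : 𝔛) : 𝔛 :=
  L.conn X (L.conn Y Z) - L.conn Y (L.conn X Z) - L.conn (L.bracket X Y) Z

lemma eq_zero_of_two_mul {a : A} (h : 2 * a = 0) : a = 0 := by
  have h2 : algebraMap ℝ A (1 / 2) * 2 = 1 := by
    rw [← map_ofNat (algebraMap ℝ A) 2, ← map_mul]
    norm_num
  calc a = (algebraMap ℝ A (1 / 2) * 2) * a := by rw [h2, one_mul]
    _ = 0 := by rw [mul_assoc, h, mul_zero]

lemma bracket_jacobi (X Y Z : 𝔛) : L.bracket X (L.bracket Y Z) =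
    L.bracket (L.bracket X Y) Z + L.bracket Y (L.bracket X Z) :=
  L.jacobi X Y Z

lemma der_bracket (X Y : 𝔛) (f : A) :
    L.der (L.bracket X Y) f = L.der X (L.der Y f) - L.der Y (L.der X f) :=
  L.der_commutator X Y f

lemma bracket_swap (X Y : 𝔛) : L.bracket X Y = -L.bracket Y X := by
  simp [bracket]

lemma bracket_sub (X Y Z : 𝔛) : L.bracket X (Y - Z) = L.bracket X Y - L.bracket X Z := by
  simp only [bracket, map_sub, AddMonoidHom.sub_apply]; abel

lemma der_two_mul (X : 𝔛) (f : A) : L.der X (2 * f) = 2 * L.der X f := by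
  rw [two_mul, map_add, two_mul]

lemma der_const_mul {c : A} (hc : ∀ X, L.der X c = 0) (X : 𝔛) (f : A) :
    L.der X (c * f) = c * L.der X f := by
  rw [Derivation.leibniz, hc, smul_zero, add_zero, smul_eq_mul]

lemma lie_metric_eq (X Y Z : 𝔛) : L.lie X (fun Y Z ↦ L.metric Y Z) Y Z =
    L.metric (L.conn Y X) Z + L.metric Y (L.conn Z X) := by
  simp only [lie, bracket, L.der_metric, map_sub, LinearMap.sub_apply]
  ring

/-- `L_X L_Y - L_Y L_X = L_[X,Y]` on biadditive forms. -/
lemma lie_lie {T : 𝔛 → 𝔛 → A} (hl : ∀ X Y Z, T (X + Y) Z = T X Z + T Y Z)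
    (hr : ∀ X Y Z, T X (Y + Z) = T X Y + T X Z) (X Y Z₁ Z₂ : 𝔛) :
    L.lie X (L.lie Y T) Z₁ Z₂ - L.lie Y (L.lie X T) Z₁ Z₂ = L.lie (L.bracket X Y) T Z₁ Z₂ := by
  have h₁ := congrArg (fun U ↦ T U Z₂) (L.bracket_jacobi X Y Z₁)
  have h₂ := congrArg (fun U ↦ T Z₁ U) (L.bracket_jacobi X Y Z₂)
  simp only [hl, hr] at h₁ h₂
  simp only [lie, map_sub, L.der_bracket, h₁, h₂]
  ring

/-- A unit vector field `ξ` with `∇_X ξ = X - g(X,ξ)ξ`. -/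
structure IsKenmotsuField (ξ : 𝔛) : Prop where
  unit : L.metric ξ ξ = 1
  conn_eq : ∀ X, L.conn X ξ = X - L.metric X ξ • ξ

/-- The horizontal part `g - η ⊗ η` of the metric, with `η = g(·,ξ)`. -/
def horiz (ξ X Y : 𝔛) : A := L.metric X Y - L.metric X ξ * L.metric Y ξ

lemma horiz_comm (ξ X Y : 𝔛) : L.horiz ξ X Y = L.horiz ξ Y X := by
  simp only [horiz, L.metric_comm X Y]; ring

namespace IsKenmotsuField

variable {L} {ξ : 𝔛}

lemma der_eta (hξ : L.IsKenmotsuField ξ) (X Y : 𝔛) :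
    L.der X (L.metric Y ξ) = L.metric (L.conn X Y) ξ + L.horiz ξ X Y := by
  rw [L.der_metric, hξ.conn_eq]
  simp only [horiz, map_sub, map_smul, smul_eq_mul, L.metric_comm Y X]

/-- `dη = 0`. -/
lemma eta_closed (hξ : L.IsKenmotsuField ξ) (X Y : 𝔛) :
    L.der X (L.metric Y ξ) - L.metric (L.bracket X Y) ξ
    = L.der Y (L.metric X ξ) := by
  rw [hξ.der_eta, hξ.der_eta]
  simp only [horiz, bracket, map_sub, LinearMap.sub_apply, L.metric_comm Y X]
  ring

lemma lie_eta (hξ : L.IsKenmotsuField ξ) (X : 𝔛) :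
    L.der ξ (L.metric X ξ) = L.metric (L.bracket ξ X) ξ := by
  have h := hξ.eta_closed ξ X
  rw [hξ.unit, Derivation.map_one_eq_zero] at h
  linear_combination h

lemma bracket_eq (hξ : L.IsKenmotsuField ξ) (X : 𝔛) :
    L.bracket ξ X = L.conn ξ X - X + L.metric X ξ • ξ := by
  rw [bracket, hξ.conn_eq]; module

/-- `L_ξ g = 2 (g - η ⊗ η)`. -/
lemma lie_metric (hξ : L.IsKenmotsuField ξ) (X Y : 𝔛) :
    L.lie ξ (fun X Y ↦ L.metric X Y) X Y = 2 * L.horiz ξ X Y := by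
  simp only [lie, hξ.bracket_eq, L.der_metric, map_sub, map_add, map_smul, LinearMap.add_apply,
    LinearMap.sub_apply, LinearMap.smul_apply, smul_eq_mul, horiz, L.metric_comm ξ Y]
  ring

lemma lie_eta_sq (hξ : L.IsKenmotsuField ξ) (X Y : 𝔛) :
    L.lie ξ (fun X Y ↦ L.metric X ξ * L.metric Y ξ) X Y = 0 := by
  simp only [lie, Derivation.leibniz, hξ.lie_eta, smul_eq_mul]
  ring

/-- `R(X,Y)ξ = η(X)Y - η(Y)X`. -/
lemma curv_field (hξ : L.IsKenmotsuField ξ) (X Y : 𝔛) :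
    L.curv X Y ξ = L.metric X ξ • Y - L.metric Y ξ • X := by
  have h := hξ.eta_closed X Y
  simp only [curv, hξ.conn_eq, map_sub, L.conn_leibniz]
  have h' : L.metric (L.bracket X Y) ξ = L.der X (L.metric Y ξ) - L.der Y (L.metric X ξ) := by
    linear_combination -h
  rw [h', bracket]
  module

/-- The Lie derivative of the connection along `ξ`. -/
lemma lie_conn (hξ : L.IsKenmotsuField ξ) (X Y : 𝔛) :
    L.bracket ξ (L.conn X Y) = L.conn (L.bracket ξ X) Y
    + L.conn X (L.bracket ξ Y) - (2 * L.horiz ξ X Y) • ξ := by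
  let D : 𝔛 → 𝔛 → 𝔛 := fun X Y ↦ L.bracket ξ (L.conn X Y) - L.conn (L.bracket ξ X) Y
    - L.conn X (L.bracket ξ Y)
  have hD : ∀ X Y, D X Y = L.bracket ξ (L.conn X Y) - L.conn (L.bracket ξ X) Y
    - L.conn X (L.bracket ξ Y) := fun _ _ ↦ rfl
  have symm : ∀ X Y, D X Y = D Y X := by
    intro X Y
    have h := L.bracket_jacobi ξ X Y
    have e₁ : L.bracket ξ (L.bracket X Y)
        = L.bracket ξ (L.conn X Y) - L.bracket ξ (L.conn Y X) := L.bracket_sub _ _ _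
    rw [e₁] at h
    rw [hD, hD]
    have e₂ : ∀ U V, L.conn U V = L.bracket U V + L.conn V U := by intro U V; simp [bracket]
    rw [e₂ (L.bracket ξ X) Y, e₂ X (L.bracket ξ Y)]
    rw [sub_eq_iff_eq_add] at h
    rw [h]
    abel
  have met : ∀ X Y Z, L.metric (D X Y) Z + L.metric Y (D X Z)
      = -2 * (L.horiz ξ X Y * L.metric Z ξ + L.metric Y ξ * L.horiz ξ X Z) := by
    intro X Y Z
    have c₁ := L.der_bracket ξ X (L.metric Y Z)
    have a₁ := hξ.lie_metric (L.conn X Y) Z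
    have a₂ := hξ.lie_metric Y (L.conn X Z)
    have a₃ := congrArg (L.der X) (hξ.lie_metric Y Z)
    rw [L.der_two_mul] at a₃
    simp only [lie, horiz, map_sub, map_add, L.der_metric, Derivation.leibniz, smul_eq_mul,
      hξ.conn_eq, map_smul] at a₁ a₂ a₃ c₁
    simp only [hD, map_sub, LinearMap.sub_apply, horiz]
    rw [L.metric_comm Y X, L.metric_comm Z X] at *
    linear_combination -a₁ - a₂ + a₃ - c₁
  have key : ∀ X Y, D X Y = (-(2 * L.horiz ξ X Y)) • ξ := by
    intro X Y
    refine L.eq_of_metric _ _ fun Z ↦ ?_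
    have m₁ := met X Y Z
    have m₂ := met Y Z X
    have m₃ := met Z X Y
    rw [symm Z X, symm Z Y] at *
    rw [← sub_eq_zero]
    refine eq_zero_of_two_mul ?_
    simp only [map_smul, LinearMap.smul_apply, smul_eq_mul, L.metric_comm ξ Z]
    rw [symm Y X, symm Y Z, L.metric_comm (D Z Y), L.horiz_comm ξ Y X, L.horiz_comm ξ Z X,
      L.horiz_comm ξ Z Y] at *
    simp only [L.metric_comm X, L.metric_comm Y, L.metric_comm Z] at *
    linear_combination m₁ + m₂ - m₃
  have := key X Y
  rw [hD, sub_sub, sub_eq_iff_eq_add] at this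
  rw [this]
  module

/-- `(L_ξ R)(X,Y)Z = -2 (P(Y,Z)X - P(X,Z)Y)` with `P = g - η ⊗ η`. -/
lemma lie_curv (hξ : L.IsKenmotsuField ξ) (X Y Z : 𝔛) : L.bracket ξ (L.curv X Y Z) =
    L.curv (L.bracket ξ X) Y Z + L.curv X (L.bracket ξ Y) Z + L.curv X Y (L.bracket ξ Z)
      - (2 * L.horiz ξ Y Z) • X + (2 * L.horiz ξ X Z) • Y := by
  have h : L.der X (L.horiz ξ Y Z) - L.horiz ξ Y (L.conn X Z) - L.der Y (L.horiz ξ X Z)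
      + L.horiz ξ X (L.conn Y Z) - L.horiz ξ (L.bracket X Y) Z
      = L.metric X ξ * L.horiz ξ Y Z - L.metric Y ξ * L.horiz ξ X Z := by
    simp only [horiz, map_sub, L.der_metric, Derivation.leibniz, smul_eq_mul, hξ.conn_eq, map_smul,
      bracket, LinearMap.sub_apply, L.metric_comm Z X, L.metric_comm Z Y, L.metric_comm Y X]
    ring
  have h' : L.der X (L.horiz ξ Y Z) = L.horiz ξ Y (L.conn X Z) + L.der Y (L.horiz ξ X Z)
      - L.horiz ξ X (L.conn Y Z) + L.horiz ξ (L.bracket X Y) Z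
      + L.metric X ξ * L.horiz ξ Y Z - L.metric Y ξ * L.horiz ξ X Z := by
    linear_combination h
  simp only [curv, L.bracket_sub, hξ.lie_conn, map_add, map_sub, L.conn_leibniz, L.der_two_mul, h',
    hξ.conn_eq, L.bracket_jacobi ξ X Y, AddMonoidHom.add_apply]
  module

/-- The Lie derivative along `ξ` of the form `g(R(U,·)·,U)`. -/
lemma lie_metric_curv (hξ : L.IsKenmotsuField ξ) (U Y Z : 𝔛) :
    L.lie ξ (fun Y Z ↦ L.metric (L.curv U Y Z) U) Y Z =
      2 * L.horiz ξ (L.curv U Y Z) U + L.metric (L.curv (L.bracket ξ U) Y Z) U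
        + L.metric (L.curv U Y Z) (L.bracket ξ U)
        - 2 * (L.horiz ξ Y Z * L.metric U U - L.horiz ξ U Z * L.metric Y U) := by
  have h₁ := hξ.lie_metric (L.curv U Y Z) U
  have h₂ := congrArg (fun T ↦ L.metric T U) (hξ.lie_curv U Y Z)
  simp only [map_add, map_sub, map_smul, LinearMap.add_apply, LinearMap.sub_apply,
    LinearMap.smul_apply, smul_eq_mul] at h₂
  simp only [lie] at h₁ ⊢
  linear_combination h₁ + h₂

/-- If `L_V g + 2S + 2ag + 2bη ⊗ η = 0` with constants `a`, `b` and a form `S` satisfying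
`S(X,ξ) = -Nη(X)` and `L_ξ S = -2N(g - η ⊗ η)`, then `(N - a - b)(g - η ⊗ η) = 0`. -/
theorem soliton_const_mul_horiz (hξ : L.IsKenmotsuField ξ) {V : 𝔛} {S : 𝔛 → 𝔛 → A} {N a b : A}
    (hN : ∀ X, L.der X N = 0) (ha : ∀ X, L.der X a = 0) (hb : ∀ X, L.der X b = 0)
    (hsol : ∀ X Y, L.lie V (fun X Y ↦ L.metric X Y) X Y + 2 * S X Y + 2 * a * L.metric X Y
      + 2 * b * (L.metric X ξ * L.metric Y ξ) = 0)
    (hS : ∀ X, S X ξ = -(N * L.metric X ξ))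
    (hLS : ∀ X Y, L.lie ξ S X Y = -(2 * N * L.horiz ξ X Y)) (X Y : 𝔛) :
    (N - a - b) * L.horiz ξ X Y = 0 := by
  set c := N - a - b with hc_def
  have hc : ∀ X, L.der X c = 0 := fun X ↦ by simp [hc_def, hN, ha, hb]
  have h2c : ∀ X, L.der X (2 * c) = 0 := fun X ↦ by rw [L.der_two_mul, hc, mul_zero]
  let g : 𝔛 → 𝔛 → A := fun X Y ↦ L.metric X Y
  let q : 𝔛 → 𝔛 → A := fun X Y ↦ L.metric X ξ * L.metric Y ξ
  set W := L.bracket ξ V with hW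
  have hVξ : L.bracket V ξ = -W := L.bracket_swap V ξ
  have h_xi : ∀ X, L.der V (L.metric X ξ) - L.metric (L.bracket V X) ξ + L.metric X W
      = 2 * c * L.metric X ξ := fun X ↦ by
    have h := hsol X ξ
    rw [hS, hξ.unit] at h
    simp only [lie, hVξ, map_neg] at h
    linear_combination h
  have eta_W : L.metric W ξ = c := by
    have h := h_xi ξ
    rw [hVξ, hξ.unit, Derivation.map_one_eq_zero, L.metric_comm ξ W] at h
    simp only [map_neg, LinearMap.neg_apply] at h
    rw [← sub_eq_zero]
    refine eq_zero_of_two_mul ?_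
    linear_combination h
  have der_f : ∀ X, L.der X (L.metric V ξ) = 2 * c * L.metric X ξ - L.metric X W := fun X ↦ by
    linear_combination h_xi X - hξ.eta_closed V X
  have bracket_W : L.bracket ξ W = (2 * c) • ξ - (2 : A) • W := by
    refine L.eq_of_metric _ _ fun X ↦ ?_
    have h := hξ.lie_metric X W
    have e₀ : L.der ξ (L.metric V ξ) = c := by
      rw [der_f, hξ.unit, L.metric_comm, eta_W]; ring
    have e₁ := L.der_bracket ξ X (L.metric V ξ)
    rw [e₀, hc, der_f, der_f, map_sub, L.der_const_mul h2c, hξ.lie_eta] at e₁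
    simp only [lie, horiz, eta_W] at h
    rw [L.metric_comm _ X, L.metric_comm _ X]
    simp only [map_sub, map_smul, smul_eq_mul]
    linear_combination -h + e₁
  have lie_W_q : ∀ X Y, L.lie W q X Y = 0 := fun X Y ↦ by
    have h : ∀ X, L.der W (L.metric X ξ) = L.metric (L.bracket W X) ξ := fun X ↦ by
      have := hξ.eta_closed W X
      rw [eta_W, hc] at this
      linear_combination this
    simp only [lie, q, Derivation.leibniz, h, smul_eq_mul]
    ring
  have q_add : (∀ X Y Z, q (X + Y) Z = q X Z + q Y Z) ∧
      ∀ X Y Z, q X (Y + Z) = q X Y + q X Z := by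
    constructor <;> intro X Y Z <;> simp only [q, map_add, LinearMap.add_apply] <;> ring
  have g_add : (∀ X Y Z, g (X + Y) Z = g X Z + g Y Z) ∧
      ∀ X Y Z, g X (Y + Z) = g X Y + g X Z := by
    constructor <;> intro X Y Z <;> simp only [g, map_add, LinearMap.add_apply]
  have lie_V_g : L.lie V g = fun X Y ↦ -(2 * (S X Y + a * g X Y + b * q X Y)) := by
    funext X Y
    linear_combination hsol X Y
  have lie_xi_g : L.lie ξ g = fun X Y ↦ 2 * (g X Y - q X Y) := by
    funext X Y; exact hξ.lie_metric X Y
  have lie_xi_q : L.lie ξ q = fun _ _ ↦ 0 := by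
    funext X Y; exact hξ.lie_eta_sq X Y
  have lie_xi_lie_V_g : ∀ X Y, L.lie ξ (L.lie V g) X Y = 4 * (N - a) * (g X Y - q X Y) :=
      fun X Y ↦ by
    have e₁ := hLS X Y
    have e₂ := congrFun (congrFun lie_xi_g X) Y
    have e₃ := congrFun (congrFun lie_xi_q X) Y
    have e₄ : L.horiz ξ X Y = g X Y - q X Y := rfl
    rw [lie_V_g]
    rw [e₄] at e₁
    simp only [lie, map_neg, L.der_two_mul, map_add, L.der_const_mul ha, L.der_const_mul hb]
      at e₁ e₂ e₃ ⊢
    linear_combination -2 * e₁ - 2 * a * e₂ - 2 * b * e₃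
  have lie_W_g : L.lie W g = fun X Y ↦
      4 * (N - a) * (g X Y - q X Y) - 2 * L.lie V g X Y + 2 * L.lie V q X Y := by
    funext X Y
    have h := L.lie_lie g_add.1 g_add.2 ξ V X Y
    rw [lie_xi_lie_V_g, lie_xi_g] at h
    simp only [lie, L.der_two_mul, map_sub] at h ⊢
    linear_combination -h
  have lie_xi_lie_V_q : L.lie ξ (L.lie V q) X Y = 0 := by
    have h := L.lie_lie q_add.1 q_add.2 ξ V X Y
    rw [lie_xi_q, lie_W_q, sub_eq_zero] at h
    rw [h]
    simp [lie]
  have hNa : ∀ X, L.der X (4 * (N - a)) = 0 := fun X ↦ by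
    rw [show (4 : A) = 2 * 2 by norm_num, mul_assoc, L.der_two_mul, L.der_two_mul, map_sub, hN, ha]
    simp
  have lie_xi_lie_W_g : L.lie ξ (L.lie W g) X Y = 0 := by
    have e₁ := lie_xi_lie_V_g X Y
    have e₂ := congrFun (congrFun lie_xi_g X) Y
    have e₃ := congrFun (congrFun lie_xi_q X) Y
    rw [lie_W_g]
    rw [lie] at e₁ lie_xi_lie_V_q e₂ e₃ ⊢
    simp only [map_sub, map_add, L.der_two_mul, L.der_const_mul hNa]
    linear_combination 4 * (N - a) * (e₂ - e₃) - 2 * e₁ + 2 * lie_xi_lie_V_q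
  have h := L.lie_lie g_add.1 g_add.2 ξ W X Y
  have h2 : ∀ X, L.der X (2 : A) = 0 := fun X ↦ by
    rw [← mul_one (2 : A), L.der_two_mul, Derivation.map_one_eq_zero, mul_zero]
  have e₁ : L.lie (L.bracket ξ W) g X Y = 2 * c * L.lie ξ g X Y - 2 * L.lie W g X Y := by
    simp only [g, L.lie_metric_eq, bracket_W, map_sub, L.conn_leibniz, h2c, h2, zero_smul, add_zero,
      map_smul, LinearMap.sub_apply, LinearMap.smul_apply, smul_eq_mul]
    ring
  have e₂ : L.lie W (L.lie ξ g) X Y = 2 * L.lie W g X Y - 2 * L.lie W q X Y := by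
    rw [lie_xi_g]
    simp only [lie, L.der_two_mul, map_sub]
    ring
  rw [lie_xi_lie_W_g, e₁, e₂, lie_W_q, lie_xi_g] at h
  refine eq_zero_of_two_mul (eq_zero_of_two_mul ?_)
  rw [horiz]
  linear_combination -h

end IsKenmotsuField

end LeviCivitaModule

open Bundle VectorField
open scoped Manifold ContDiff

noncomputable section

namespace RiemannianGeometry

set_option linter.unusedSectionVars false

open Filter InnerProductSpace
open scoped Topology

variable {E : Type*} [NormedAddCommGroup E] [NormedSpace ℝ E] [FiniteDimensional ℝ E]
  {H : Type*} [TopologicalSpace H] {I : ModelWithCorners ℝ E H}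
  {M : Type*} [TopologicalSpace M] [ChartedSpace H M] [IsManifold I ∞ M]

/-- A vector field that is smooth near `x` agrees near `x` with a globally smooth one. -/
lemma exists_contMDiff_eventuallyEq [T2Space M] {x : M} {X : Π x : M, TangentSpace I x} {u : Set M}
    (hu : u ∈ 𝓝 x) (hX : CMDiff[u] ∞ (T% X)) :
    ∃ Y : Π x : M, TangentSpace I x, CMDiff ∞ (T% Y) ∧ ∀ᶠ y in 𝓝 x, Y y = X y := by
  obtain ⟨v, hvu, hv, hxv⟩ := mem_nhds_iff.1 hu
  obtain ⟨ψ, hψ, -⟩ :=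
    (SmoothBumpFunction.nhds_basis_support (I := I) (hv.mem_nhds hxv)).mem_iff.1
      (hv.mem_nhds hxv)
  refine ⟨(ψ : M → ℝ) • X, ψ.contMDiff.contMDiffOn.smul_section_of_tsupport hv hψ (hX.mono hvu), ?_⟩
  filter_upwards [ψ.eventuallyEq_one] with y hy
  simp [hy]

/-- The derivative of a smooth function along a smooth vector field is smooth. -/
lemma contMDiff_mvfderiv_apply {f : M → ℝ} {X : Π x : M, TangentSpace I x}
    (hf : CMDiff ∞ f) (hX : CMDiff ∞ (T% X)) : CMDiff ∞ (fun x ↦ mvfderiv I f x (X x)) := by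
  have h := (hf.contMDiff_tangentMap (m := ∞) (by simp)).comp hX
  intro x
  have h' := (contMDiffAt_totalSpace.1 (h x)).2
  simpa [tangentMap, Function.comp_def, TangentBundle.trivializationAt_apply] using! h'

variable (I M) in
/-- The ring of smooth functions. -/
abbrev SmoothFun := C^∞⟮I, M; 𝓘(ℝ, ℝ), ℝ⟯

variable (I M) in
/-- The module of smooth vector fields. -/
abbrev SmoothField := Cₛ^∞⟮I; E, (fun x : M ↦ TangentSpace I x)⟯

instance : SMul (SmoothFun I M) (SmoothField I M) :=
  ⟨fun f X ↦ ⟨fun x ↦ f x • X x, f.contMDiff.smul_section X.contMDiff⟩⟩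

instance : Module (SmoothFun I M) (SmoothField I M) where
  one_smul X := by ext x; exact one_smul ℝ (X x)
  mul_smul f g X := by ext x; exact mul_smul (f x) (g x) (X x)
  smul_zero f := by ext x; exact smul_zero (f x)
  smul_add f X Y := by ext x; exact smul_add (f x) (X x) (Y x)
  add_smul f g X := by ext x; exact add_smul (f x) (g x) (X x)
  zero_smul X := by ext x; exact zero_smul ℝ (X x)

section LinearAlgebra

variable {ι V : Type*} [Fintype ι] [NormedAddCommGroup V] [InnerProductSpace ℝ V]

lemma sum_inner_skew (b : OrthonormalBasis ι ℝ V) (T : V →ₗ[ℝ] V) {a : ι → V}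
    (ha : ∀ i j, inner ℝ (b j) (a i) + inner ℝ (b i) (a j) = 0) :
    ∑ i, (inner ℝ (T (a i)) (b i) + inner ℝ (T (b i)) (a i)) = 0 := by
  have h₁ : ∀ i, inner ℝ (T (a i)) (b i) = ∑ j, inner ℝ (T (b j)) (b i) * inner ℝ (b j) (a i) := by
    intro i
    conv_lhs => rw [← b.sum_repr' (a i)]
    simp [sum_inner, real_inner_smul_left, mul_comm]
  have h₂ : ∀ i, inner ℝ (T (b i)) (a i) = ∑ j, inner ℝ (T (b i)) (b j) * inner ℝ (b j) (a i) :=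
    fun i ↦ (b.sum_inner_mul_inner _ _).symm
  simp only [Finset.sum_add_distrib, h₁, h₂]
  rw [Finset.sum_comm (f := fun i j ↦ inner ℝ (T (b i)) (b j) * inner ℝ (b j) (a i)),
    ← Finset.sum_add_distrib]
  refine Finset.sum_eq_zero fun i _ ↦ ?_
  rw [← Finset.sum_add_distrib]
  refine Finset.sum_eq_zero fun j _ ↦ ?_
  rw [← mul_add, ha, mul_zero]

lemma sum_inner_skew_horizontal (b : OrthonormalBasis ι ℝ V) (T : V →ₗ[ℝ] V) {a : ι → V} (w : V)
    (ha : ∀ i j, inner ℝ (a i) (b j) + inner ℝ (b i) (a j)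
      = -(2 * (inner ℝ (b i) (b j) - inner ℝ (b i) w * inner ℝ (b j) w))) :
    ∑ i, (2 * (inner ℝ (T (b i)) (b i) - inner ℝ (T (b i)) w * inner ℝ (b i) w)
      + inner ℝ (T (a i)) (b i) + inner ℝ (T (b i)) (a i)) = 0 := by
  have h := sum_inner_skew b T (a := fun i ↦ a i + b i - inner ℝ (b i) w • w) fun i j ↦ by
    have := ha i j
    simp only [inner_add_right, inner_sub_right, real_inner_smul_right]
    rw [real_inner_comm] at this
    rw [real_inner_comm (b i) (b j)]
    linarith
  have e₁ : ∑ i, inner ℝ (T w) (b i) * inner ℝ (b i) w = inner ℝ (T w) w :=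
    b.sum_inner_mul_inner _ _
  have e₂ : ∑ i, inner ℝ (T (b i)) w * inner ℝ (b i) w = inner ℝ (T w) w := by
    have h' : T w = ∑ i, inner ℝ (b i) w • T (b i) := by
      conv_lhs => rw [← b.sum_repr' w]
      simp
    rw [h']
    simp [sum_inner, real_inner_smul_left, mul_comm]
  rw [← h, ← sub_eq_zero, ← Finset.sum_sub_distrib]
  have : ∑ i, (inner ℝ (T w) (b i) * inner ℝ (b i) w - inner ℝ (T (b i)) w * inner ℝ (b i) w)
      = 0 := by
    rw [Finset.sum_sub_distrib, e₁, e₂, sub_self]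
  rw [← this]
  refine Finset.sum_congr rfl fun i _ ↦ ?_
  simp only [map_add, map_sub, map_smul, inner_add_right, inner_sub_right, real_inner_smul_right,
    inner_add_left, inner_sub_left, real_inner_smul_left]
  ring

end LinearAlgebra

variable [RiemannianBundle (fun x : M ↦ TangentSpace I x)]
  [IsContMDiffRiemannianBundle I ∞ E (fun x : M ↦ TangentSpace I x)]

lemma contMDiffOn_inner {X Y : Π x : M, TangentSpace I x} {u : Set M}
    (hX : CMDiff[u] ∞ (T% X)) (hY : CMDiff[u] ∞ (T% Y)) :
    CMDiff[u] ∞ (fun y ↦ inner ℝ (X y) (Y y)) :=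
  ContMDiffOn.inner_bundle (IB := I) (F := E) (E := fun x : M ↦ TangentSpace I x) hX hY

lemma contMDiff_inner {X Y : Π x : M, TangentSpace I x}
    (hX : CMDiff ∞ (T% X)) (hY : CMDiff ∞ (T% Y)) :
    CMDiff ∞ (fun y ↦ inner ℝ (X y) (Y y)) :=
  ContMDiff.inner_bundle (IB := I) (F := E) (E := fun x : M ↦ TangentSpace I x) hX hY

/-- Near every point there is a smooth orthonormal frame. -/
lemma exists_orthonormal_frame [T2Space M] (x : M) :
    ∃ e : Fin (Module.finrank ℝ E) → Π x : M, TangentSpace I x,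
      (∀ i, CMDiff ∞ (T% (e i))) ∧ ∀ᶠ y in 𝓝 x, Orthonormal ℝ (fun i ↦ e i y) := by
  let t := trivializationAt E (fun x : M ↦ TangentSpace I x) x
  let b := Module.finBasis ℝ E
  let s := t.localFrame b
  have hs : IsLocalFrameOn I E ∞ s t.baseSet := t.isLocalFrameOn_localFrame_baseSet I ∞ b
  have hne : ∀ i, ∀ y ∈ t.baseSet, gramSchmidt ℝ (fun j ↦ s j y) i ≠ 0 := fun i y hy ↦
    gramSchmidt_ne_zero i (hs.linearIndependent hy)
  have hg : ∀ i, CMDiff[t.baseSet] ∞ (T% fun y ↦ gramSchmidt ℝ (fun j ↦ s j y) i) := by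
    intro i
    induction i using WellFoundedLT.induction with
    | ind i ih =>
      have hsum : CMDiff[t.baseSet] ∞ (T% fun y ↦ ∑ k ∈ Finset.Iio i,
          (inner ℝ (gramSchmidt ℝ (fun j ↦ s j y) k) (s i y)
            / inner ℝ (gramSchmidt ℝ (fun j ↦ s j y) k) (gramSchmidt ℝ (fun j ↦ s j y) k) : ℝ)
              • gramSchmidt ℝ (fun j ↦ s j y) k) := by
        refine ContMDiffOn.sum_section fun k hk ↦ ?_
        have hk := ih k (Finset.mem_Iio.1 hk)
        refine ContMDiffOn.smul_section ?_ hk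
        exact (contMDiffOn_inner hk (hs.contMDiffOn i)).div₀ (contMDiffOn_inner hk hk)
          fun y hy ↦ by simpa using hne k y hy
      refine ((hs.contMDiffOn i).sub_section hsum).congr fun y hy ↦ ?_
      have := gramSchmidt_def'' ℝ (fun j ↦ s j y) i
      rw [← sub_eq_iff_eq_add] at this
      simp [← this]
  have hn : ∀ i, CMDiff[t.baseSet] ∞ (T% fun y ↦ gramSchmidtNormed ℝ (fun j ↦ s j y) i) := by
    intro i
    have h1 : CMDiff[t.baseSet] ∞ (fun y ↦ ‖gramSchmidt ℝ (fun j ↦ s j y) i‖⁻¹) := by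
      have h2 : CMDiff[t.baseSet] ∞ (fun y ↦ ‖gramSchmidt ℝ (fun j ↦ s j y) i‖) := by
        intro y hy
        have h3 := contMDiffOn_inner (hg i) (hg i) y hy
        have h4 : ContDiffAt ℝ ∞ Real.sqrt (inner ℝ (gramSchmidt ℝ (fun j ↦ s j y) i)
            (gramSchmidt ℝ (fun j ↦ s j y) i)) :=
          Real.contDiffAt_sqrt (by simpa using hne i y hy)
        have := h4.contMDiffAt.comp_contMDiffWithinAt y h3
        refine this.congr (fun z _ ↦ ?_) ?_ <;>
        simp [Real.sqrt_sq]
      exact h2.inv₀ fun y hy ↦ by simpa using hne i y hy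
    exact h1.smul_section (hg i)
  have hx : t.baseSet ∈ 𝓝 x :=
    t.open_baseSet.mem_nhds (FiberBundle.mem_baseSet_trivializationAt' x)
  choose e he hes using fun i ↦ exists_contMDiff_eventuallyEq hx (hn i)
  refine ⟨e, he, ?_⟩
  filter_upwards [hx, eventually_all.2 hes] with y hy hye
  simp only [hye]
  exact gramSchmidtNormed_orthonormal (hs.linearIndependent hy)

/-- The orthonormal basis given by an orthonormal frame. -/
def frameBasis {y : M} {e : Fin (Module.finrank ℝ E) → TangentSpace I y} (he : Orthonormal ℝ e) :
    OrthonormalBasis (Fin (Module.finrank ℝ E)) ℝ (TangentSpace I y) :=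
  OrthonormalBasis.mk he
    (he.linearIndependent.span_eq_top_of_card_eq_finrank' (Fintype.card_fin _)).ge

@[simp]
lemma coe_frameBasis {y : M} {e : Fin (Module.finrank ℝ E) → TangentSpace I y}
    (he : Orthonormal ℝ e) : ⇑(frameBasis he) = e := OrthonormalBasis.coe_mk ..

lemma nabla_eq_sum {y : M} {e : Fin (Module.finrank ℝ E) → Π x : M, TangentSpace I x}
    (he : Orthonormal ℝ fun i ↦ e i y) (X Y : Π x : M, TangentSpace I x) :
    nabla X Y y = ∑ i, (inner ℝ (e i y) (X y) : ℝ) • nabla (e i) Y y := by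
  conv_lhs => rw [nabla, ← (frameBasis he).sum_repr' (X y)]
  simp [nabla]

lemma contMDiff_mlieBracket {X Y : Π x : M, TangentSpace I x}
    (hX : CMDiff ∞ (T% X)) (hY : CMDiff ∞ (T% Y)) : CMDiff ∞ (T% (mlieBracket I X Y)) :=
  haveI : IsManifold I (minSmoothness ℝ 2) M := by
    rw [minSmoothness_of_isRCLikeNormedField]; infer_instance
  haveI : IsManifold I (((⊤ : ℕ∞) : WithTop ℕ∞) + 1) M := ‹IsManifold I ∞ M›
  ContDiff.mlieBracket_vectorField (m := ⊤) (n := ⊤) hX hY (by simp)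

lemma contMDiff_koszul {X Y Z : Π x : M, TangentSpace I x} (hX : CMDiff ∞ (T% X))
    (hY : CMDiff ∞ (T% Y)) (hZ : CMDiff ∞ (T% Z)) : CMDiff ∞ (koszul X Y Z) := by
  have h1 := contMDiff_mvfderiv_apply (contMDiff_inner hY hZ) hX
  have h2 := contMDiff_mvfderiv_apply (contMDiff_inner hZ hX) hY
  have h3 := contMDiff_mvfderiv_apply (contMDiff_inner hX hY) hZ
  have h4 := contMDiff_inner (contMDiff_mlieBracket hX hY) hZ
  have h5 := contMDiff_inner (contMDiff_mlieBracket hX hZ) hY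
  have h6 := contMDiff_inner (contMDiff_mlieBracket hY hZ) hX
  exact contMDiff_const.mul (((((h1.add h2).sub h3).add h4).sub h5).sub h6)

/-- `∇_X Y` is smooth for smooth `X` and `Y`. -/
lemma contMDiff_nabla [T2Space M] {X Y : Π x : M, TangentSpace I x} (hX : CMDiff ∞ (T% X))
    (hY : CMDiff ∞ (T% Y)) : CMDiff ∞ (T% (nabla X Y)) := by
  intro x
  obtain ⟨e, he, heo⟩ := exists_orthonormal_frame (I := I) x
  have h : CMDiff ∞ (T% fun y ↦ ∑ i, koszul X Y (e i) y • e i y) :=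
    ContMDiff.sum_section fun i _ ↦ (contMDiff_koszul hX hY (he i)).smul_section (he i)
  refine (h x).congr_of_eventuallyEq ?_
  filter_upwards [heo] with y hy
  congr 1
  conv_lhs => rw [← (frameBasis hy).sum_repr' (nabla X Y y)]
  refine Finset.sum_congr rfl fun i _ ↦ ?_
  rw [coe_frameBasis, real_inner_comm, nabla, inner_leviCivita
    (hX.mdifferentiable (by simp) y) (hY.mdifferentiable (by simp) y)
    ((he i).mdifferentiable (by simp) y)]

lemma mdifferentiableAt_nabla [T2Space M] {U Z : Π x : M, TangentSpace I x} {x : M}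
    (hU : MDiffAt (T% U) x) (hZ : CMDiff ∞ (T% Z)) : MDiffAt (T% (nabla U Z)) x := by
  obtain ⟨e, he, heo⟩ := exists_orthonormal_frame (I := I) x
  have h : MDiffAt (T% fun y ↦ ∑ i, (inner ℝ (e i y) (U y) : ℝ) • nabla (e i) Z y) x :=
    .sum_section fun i _ ↦ (mdifferentiableAt_inner ((he i).mdifferentiable (by simp) x)
      hU).smul_section ((contMDiff_nabla (he i) hZ).mdifferentiable (by simp) x)
  refine h.congr_of_eventuallyEq ?_
  filter_upwards [heo] with y hy
  rw [nabla_eq_sum hy]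

lemma mlieBracket_jacobi {X Y Z : Π x : M, TangentSpace I x} (hX : CMDiff ∞ (T% X))
    (hY : CMDiff ∞ (T% Y)) (hZ : CMDiff ∞ (T% Z)) (x : M) :
    mlieBracket I X (mlieBracket I Y Z) x =
      mlieBracket I (mlieBracket I X Y) Z x + mlieBracket I Y (mlieBracket I X Z) x := by
  have h2 : minSmoothness ℝ 2 ≤ (∞ : WithTop ℕ∞) := by
    rw [minSmoothness_of_isRCLikeNormedField]; exact WithTop.coe_le_coe.2 le_top
  have : IsManifold I (minSmoothness ℝ 3) M := by
    rw [minSmoothness_of_isRCLikeNormedField]; infer_instance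
  exact leibniz_identity_mlieBracket_apply ((hX x).of_le h2) ((hY x).of_le h2) ((hZ x).of_le h2)

lemma mdiffAt_section_of_contMDiff {X : Π x : M, TangentSpace I x} (hX : CMDiff ∞ (T% X)) (x : M) :
    MDiffAt (T% X) x :=
  hX.mdifferentiable (by simp) x

lemma mdiffAt_of_contMDiff {f : M → ℝ} (hf : CMDiff ∞ f) (x : M) : MDiffAt f x :=
  hf.mdifferentiable (by simp) x

lemma exists_contMDiff_apply_eq [T2Space M] {x : M} (v : TangentSpace I x) :
    ∃ X : Π x : M, TangentSpace I x, CMDiff ∞ (T% X) ∧ X x = v := by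
  obtain ⟨u, hu, h⟩ := FiberBundle.exists_contMDiffOn_extend (k := ∞) I E v
  obtain ⟨X, hX, hXv⟩ := exists_contMDiff_eventuallyEq hu h
  exact ⟨X, hX, by simpa using hXv.self_of_nhds⟩

/-- The Lie bracket acts on functions as the commutator of derivations. -/
lemma mvfderiv_mlieBracket [T2Space M] {X Y : Π x : M, TangentSpace I x} {f : M → ℝ}
    (hX : CMDiff ∞ (T% X)) (hY : CMDiff ∞ (T% Y)) (hf : CMDiff ∞ f) (x : M) :
    mvfderiv I f x (mlieBracket I X Y x) =
      mvfderiv I (fun y ↦ mvfderiv I f y (Y y)) x (X x)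
        - mvfderiv I (fun y ↦ mvfderiv I f y (X y)) x (Y x) := by
  rcases subsingleton_or_nontrivial (TangentSpace I x) with hs | hs
  · simp [Subsingleton.elim _ (0 : TangentSpace I x)]
  obtain ⟨v, hv⟩ := exists_ne (0 : TangentSpace I x)
  obtain ⟨Z, hZ, rfl⟩ := exists_contMDiff_apply_eq v
  have bracket_smul : ∀ {U : Π x : M, TangentSpace I x},
      mlieBracket I U (f • Z) = (fun y ↦ mvfderiv I f y (U y)) • Z + f • mlieBracket I U Z := by
    intro U
    funext y
    exact mlieBracket_smul_right (mdiffAt_of_contMDiff hf y) (mdiffAt_section_of_contMDiff hZ y)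
  have iter : ∀ {U W : Π x : M, TangentSpace I x}, CMDiff ∞ (T% U) → CMDiff ∞ (T% W) →
      mlieBracket I U (mlieBracket I W (f • Z)) x =
        mvfderiv I (fun y ↦ mvfderiv I f y (W y)) x (U x) • Z x
        + mvfderiv I f x (W x) • mlieBracket I U Z x
        + (mvfderiv I f x (U x) • mlieBracket I W Z x
          + f x • mlieBracket I U (mlieBracket I W Z) x) := by
    intro U W hU hW
    have h1 := contMDiff_mvfderiv_apply hf hW
    have h2 := contMDiff_mlieBracket hW hZ
    rw [bracket_smul, mlieBracket_add_right
      (mdiffAt_section_of_contMDiff (h1.smul_section hZ) x)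
      (mdiffAt_section_of_contMDiff (hf.smul_section h2) x),
      mlieBracket_smul_right (mdiffAt_of_contMDiff h1 x) (mdiffAt_section_of_contMDiff hZ x),
      mlieBracket_smul_right (mdiffAt_of_contMDiff hf x) (mdiffAt_section_of_contMDiff h2 x)]
  have key := mlieBracket_jacobi hX hY (hf.smul_section hZ) x
  rw [iter hX hY, iter hY hX, bracket_smul, mlieBracket_jacobi hX hY hZ x] at key
  simp only [Pi.add_apply, Pi.smul_apply', smul_add] at key
  refine smul_left_injective ℝ hv ?_
  dsimp only
  rw [sub_smul, eq_sub_iff_add_eq]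
  rw [← sub_eq_zero] at key ⊢
  rw [← neg_eq_zero, ← key]
  abel

lemma nabla_sub_nabla {X Y : Π x : M, TangentSpace I x} {x : M}
    (hX : MDiffAt (T% X) x) (hY : MDiffAt (T% Y) x) :
    nabla X Y x - nabla Y X x = mlieBracket I X Y x :=
  (leviCivita I M).torsion_eq_zero_iff.1 leviCivita_torsion hX hY

lemma nabla_add_right {X Y Z : Π x : M, TangentSpace I x} {x : M}
    (hY : MDiffAt (T% Y) x) (hZ : MDiffAt (T% Z) x) :
    nabla X (Y + Z) x = nabla X Y x + nabla X Z x := by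
  simp only [nabla, (leviCivita I M).isCovariantDerivativeOnUniv.add hY hZ]
  rfl

lemma nabla_smul_right {X Y : Π x : M, TangentSpace I x} {f : M → ℝ} {x : M}
    (hf : MDiffAt f x) (hY : MDiffAt (T% Y) x) :
    nabla X (f • Y) x = f x • nabla X Y x + mvfderiv I f x (X x) • Y x := by
  simp only [nabla, (leviCivita I M).isCovariantDerivativeOnUniv.leibniz hY hf]
  rfl

variable (I M) in
/-- The smooth vector fields of a Riemannian manifold with the Levi-Civita connection. -/
def smoothLeviCivita [T2Space M] : LeviCivitaModule (SmoothFun I M) (SmoothField I M) where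
  der :=
    { toFun := fun X ↦ Derivation.mk'
        { toFun := fun f ↦ ⟨fun x ↦ mvfderiv I f x (X x),
            contMDiff_mvfderiv_apply f.contMDiff X.contMDiff⟩
          map_add' := fun f g ↦ by
            ext x
            change mvfderiv I (⇑f + ⇑g) x (X x) = _
            rw [mvfderiv_add f.mdifferentiableAt g.mdifferentiableAt]
            rfl
          map_smul' := fun c f ↦ by
            ext x
            have h := mvfderiv_smul (I := I) (x := x) (a := fun _ : M ↦ c) mdifferentiableAt_const
              (f.mdifferentiableAt (x := x))
            change mvfderiv I ((fun _ : M ↦ c) • ⇑f) x (X x) = c • mvfderiv I f x (X x)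
            rw [h, mvfderiv_const]
            simp }
        fun f g ↦ by
          ext x
          change mvfderiv I (⇑f * ⇑g) x (X x)
            = f x * mvfderiv I g x (X x) + g x * mvfderiv I f x (X x)
          rw [mvfderiv_mul f.mdifferentiableAt g.mdifferentiableAt]
          simp
      map_add' := fun X Y ↦ by
        ext f x
        exact map_add (mvfderiv I f x) (X x) (Y x)
      map_smul' := fun h X ↦ by
        ext f x
        exact map_smul (mvfderiv I f x) (h x) (X x) }
  metric := LinearMap.mk₂ _
    (fun X Y ↦ ⟨fun x ↦ inner ℝ (X x) (Y x), contMDiff_inner X.contMDiff Y.contMDiff⟩)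
    (fun X Y Z ↦ by ext x; exact inner_add_left (X x) (Y x) (Z x))
    (fun f X Y ↦ by ext x; exact real_inner_smul_left (X x) (Y x) (f x))
    (fun X Y Z ↦ by ext x; exact inner_add_right (X x) (Y x) (Z x))
    (fun f X Y ↦ by ext x; exact real_inner_smul_right (X x) (Y x) (f x))
  conn :=
    { toFun := fun X ↦ AddMonoidHom.mk'
        (fun Y ↦ ⟨nabla X Y, contMDiff_nabla X.contMDiff Y.contMDiff⟩)
        fun Y Z ↦ by ext x; exact nabla_add_right Y.mdifferentiableAt Z.mdifferentiableAt
      map_add' := fun X Y ↦ by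
        ext Z x
        exact map_add (leviCivita I M Z x) (X x) (Y x)
      map_smul' := fun f X ↦ by
        ext Z x
        exact map_smul (leviCivita I M Z x) (f x) (X x) }
  metric_comm X Y := by ext x; exact real_inner_comm (Y x) (X x)
  eq_of_metric X Y h := by
    ext x
    refine ext_inner_right ℝ fun v ↦ ?_
    obtain ⟨Z, hZ, rfl⟩ := exists_contMDiff_apply_eq v
    exact DFunLike.congr_fun (h ⟨Z, hZ⟩) x
  conn_leibniz X f Y := by
    ext x
    exact nabla_smul_right f.mdifferentiableAt Y.mdifferentiableAt
  der_metric X Y Z := by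
    ext x
    exact leviCivita_metric X.mdifferentiableAt Y.mdifferentiableAt Z.mdifferentiableAt
  der_commutator X Y f := by
    ext x
    have h := mvfderiv_mlieBracket X.contMDiff Y.contMDiff f.contMDiff x
    rw [← nabla_sub_nabla X.mdifferentiableAt Y.mdifferentiableAt] at h
    exact h
  jacobi X Y Z := by
    have br : ∀ X Y : SmoothField I M, nabla (⇑X) (⇑Y) - nabla (⇑Y) (⇑X) = mlieBracket I X Y :=
      fun X Y ↦ funext fun x ↦ nabla_sub_nabla X.mdifferentiableAt Y.mdifferentiableAt
    ext x
    have h := mlieBracket_jacobi X.contMDiff Y.contMDiff Z.contMDiff x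
    have hm : ∀ X Y : SmoothField I M, MDiffAt (T% (mlieBracket I (⇑X) (⇑Y))) x := fun X Y ↦
      mdiffAt_section_of_contMDiff (contMDiff_mlieBracket X.contMDiff Y.contMDiff) x
    rw [← nabla_sub_nabla X.mdifferentiableAt (hm Y Z),
      ← nabla_sub_nabla Y.mdifferentiableAt (hm X Z),
      ← nabla_sub_nabla (hm X Y) Z.mdifferentiableAt] at h
    simp only [← br] at h
    exact h

lemma smoothLeviCivita_metric_apply [T2Space M] (X Y : SmoothField I M) (x : M) :
    (smoothLeviCivita I M).metric X Y x = inner ℝ (X x) (Y x) := rfl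

lemma coe_smoothLeviCivita_bracket [T2Space M] (X Y : SmoothField I M) :
    ⇑((smoothLeviCivita I M).bracket X Y) = mlieBracket I X Y :=
  funext fun _ ↦ nabla_sub_nabla X.mdifferentiableAt Y.mdifferentiableAt

lemma coe_smoothLeviCivita_curv [T2Space M] (X Y Z : SmoothField I M) :
    ⇑((smoothLeviCivita I M).curv X Y Z) = curvature X Y Z := by
  funext x
  change nabla X (nabla Y Z) x - nabla Y (nabla X Z) x
    - nabla ((smoothLeviCivita I M).bracket X Y) Z x = _
  rw [coe_smoothLeviCivita_bracket]
  rfl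

/-- The curvature `R(U,Y)Z` is tensorial in `U`. -/
lemma curvature_tensorialAt [T2Space M] (Y : Π x : M, TangentSpace I x)
    {Z : Π x : M, TangentSpace I x} (hZ : CMDiff ∞ (T% Z)) (x : M) :
    TensorialAt I E (fun U ↦ curvature U Y Z x) x where
  smul {f U} hf hU := by
    have h : nabla (f • U) Z = f • nabla U Z := by
      funext y; exact map_smul (leviCivita I M Z y) (f y) (U y)
    simp only [curvature, h, nabla_smul_right hf (mdifferentiableAt_nabla hU hZ)]
    simp only [nabla, mlieBracket_smul_left hf hU, map_add, map_smul, Pi.smul_apply']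
    simp only [neg_smul]
    module
  add {U U'} hU hU' := by
    have h : nabla (U + U') Z = nabla U Z + nabla U' Z := by
      funext y; exact map_add (leviCivita I M Z y) (U y) (U' y)
    simp only [curvature, h, nabla_add_right (mdifferentiableAt_nabla hU hZ)
      (mdifferentiableAt_nabla hU' hZ)]
    simp only [nabla, mlieBracket_add_left hU hU', map_add, Pi.add_apply]
    abel

variable [T2Space M]

/-- The Ricci tensor computed in a frame of smooth fields that is orthonormal at the point. -/
lemma ricci_eq_sum {Y Z : Π x : M, TangentSpace I x} (hZ : CMDiff ∞ (T% Z)) {x : M}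
    {e : Fin (Module.finrank ℝ E) → Π x : M, TangentSpace I x} (he : ∀ i, MDiffAt (T% (e i)) x)
    (heo : Orthonormal ℝ fun i ↦ e i x) :
    ricci Y Z x = ∑ i, inner ℝ (curvature (e i) Y Z x) (e i x) := by
  let T := TensorialAt.mkHom (fun U ↦ curvature U Y Z x) x (curvature_tensorialAt Y hZ x)
  have h₁ := LinearMap.trace_eq_sum_inner (T : TangentSpace I x →ₗ[ℝ] TangentSpace I x)
    (stdOrthonormalBasis ℝ (TangentSpace I x))
  have h₂ := LinearMap.trace_eq_sum_inner (T : TangentSpace I x →ₗ[ℝ] TangentSpace I x)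
    (frameBasis heo)
  rw [h₁] at h₂
  have h₃ : ∀ i, T (e i x) = curvature (e i) Y Z x := fun i ↦ TensorialAt.mkHom_apply _ (he i)
  simp only [coe_frameBasis, ContinuousLinearMap.coe_coe, h₃] at h₂
  simp only [ricci, real_inner_comm _ (curvature _ _ _ _)]
  exact h₂

lemma contMDiff_ricci {Y Z : Π x : M, TangentSpace I x} (hY : CMDiff ∞ (T% Y))
    (hZ : CMDiff ∞ (T% Z)) : CMDiff ∞ (ricci Y Z) := by
  intro x
  obtain ⟨e, he, heo⟩ := exists_orthonormal_frame (I := I) x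
  have hc : ∀ i, CMDiff ∞ (T% (curvature (e i) Y Z)) := fun i ↦ by
    have := ((smoothLeviCivita I M).curv ⟨e i, he i⟩ ⟨Y, hY⟩ ⟨Z, hZ⟩).contMDiff
    rwa [coe_smoothLeviCivita_curv] at this
  have h : CMDiff ∞ (fun y ↦ ∑ i, inner ℝ (curvature (e i) Y Z y) (e i y)) :=
    contMDiff_finsetSum fun i _ ↦ contMDiff_inner (hc i) (he i)
  refine (h x).congr_of_eventuallyEq ?_
  filter_upwards [heo] with y hy
  exact ricci_eq_sum hZ (fun i ↦ mdiffAt_section_of_contMDiff (he i) y) hy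

variable (I M) in
/-- The Ricci tensor on smooth vector fields. -/
def smoothRicci (Y Z : SmoothField I M) : SmoothFun I M :=
  ⟨ricci Y Z, contMDiff_ricci Y.contMDiff Z.contMDiff⟩

lemma smoothRicci_apply (Y Z : SmoothField I M) (x : M) : smoothRicci I M Y Z x = ricci Y Z x := rfl

lemma smoothFun_two_apply (x : M) : (2 : SmoothFun I M) x = 2 :=
  map_ofNat (ContMDiffMap.evalRingHom (I := I) (I' := 𝓘(ℝ, ℝ)) (n := ∞) (R := ℝ) x) 2

lemma smoothFun_algebraMap_apply (c : ℝ) (x : M) : algebraMap ℝ (SmoothFun I M) c x = c := rfl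

lemma smoothFun_sum_apply {ι : Type*} (s : Finset ι) (f : ι → SmoothFun I M) (x : M) :
    (∑ i ∈ s, f i) x = ∑ i ∈ s, f i x :=
  map_sum (ContMDiffMap.evalRingHom (I := I) (I' := 𝓘(ℝ, ℝ)) (n := ∞) (R := ℝ) x) f s

lemma der_congr_of_eventuallyEq (X : SmoothField I M) {f g : SmoothFun I M} {x : M}
    (h : ⇑f =ᶠ[𝓝 x] ⇑g) :
    (smoothLeviCivita I M).der X f x = (smoothLeviCivita I M).der X g x := by
  change mfderiv% f x (X x) = mfderiv% g x (X x)
  rw [h.mfderiv_eq]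
  rfl

lemma horiz_apply (ξ X Y : SmoothField I M) (x : M) : (smoothLeviCivita I M).horiz ξ X Y x
    = inner ℝ (X x) (Y x) - inner ℝ (X x) (ξ x) * inner ℝ (Y x) (ξ x) := rfl

lemma lie_apply (X Y Z : SmoothField I M) (T : SmoothField I M → SmoothField I M → SmoothFun I M)
    (x : M) : (smoothLeviCivita I M).lie X T Y Z x = (smoothLeviCivita I M).der X (T Y Z) x
      - T ((smoothLeviCivita I M).bracket X Y) Z x
      - T Y ((smoothLeviCivita I M).bracket X Z) x := rfl

/-- `S(X,ξ) = -(dim M - 1) η(X)`. -/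
lemma smoothRicci_field {ξ : SmoothField I M} (hξ : (smoothLeviCivita I M).IsKenmotsuField ξ)
    (X : SmoothField I M) :
    smoothRicci I M X ξ = -(algebraMap ℝ (SmoothFun I M) (Module.finrank ℝ E - 1)
      * (smoothLeviCivita I M).metric X ξ) := by
  ext x
  obtain ⟨e, he, heo⟩ := exists_orthonormal_frame (I := I) x
  have heo := heo.self_of_nhds
  rw [smoothRicci_apply,
    ricci_eq_sum ξ.contMDiff (fun i ↦ mdiffAt_section_of_contMDiff (he i) x) heo]
  have h₁ : ∀ i, inner ℝ (curvature (e i) X ξ x) (e i x)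
      = inner ℝ (X x) (e i x) * inner ℝ (e i x) (ξ x) - inner ℝ (X x) (ξ x) := by
    intro i
    have h := DFunLike.congr_fun (hξ.curv_field ⟨e i, he i⟩ X) x
    rw [coe_smoothLeviCivita_curv] at h
    have h' : curvature (e i) X ξ x
      = (inner ℝ (e i x) (ξ x) : ℝ) • X x - (inner ℝ (X x) (ξ x) : ℝ) • e i x := h
    rw [h', inner_sub_left, real_inner_smul_left, real_inner_smul_left,
      real_inner_self_eq_norm_sq, heo.1 i]
    ring
  have h₂ := (frameBasis heo).sum_inner_mul_inner (X x) (ξ x)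
  simp only [coe_frameBasis] at h₂
  simp only [h₁, Finset.sum_sub_distrib, h₂]
  change _ = -((Module.finrank ℝ E - 1 : ℝ) * inner ℝ (X x) (ξ x))
  simp
  ring

/-- `L_ξ S = -2 (dim M - 1) (g - η ⊗ η)`. -/
lemma lie_smoothRicci {ξ : SmoothField I M} (hξ : (smoothLeviCivita I M).IsKenmotsuField ξ)
    (Y Z : SmoothField I M) :
    (smoothLeviCivita I M).lie ξ (smoothRicci I M) Y Z =
      -(2 * algebraMap ℝ (SmoothFun I M) (Module.finrank ℝ E - 1)
        * (smoothLeviCivita I M).horiz ξ Y Z) := by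
  ext x
  obtain ⟨e', he', heo⟩ := exists_orthonormal_frame (I := I) x
  let L := smoothLeviCivita I M
  let e : Fin (Module.finrank ℝ E) → SmoothField I M := fun i ↦ ⟨e' i, he' i⟩
  replace heo : ∀ᶠ y in 𝓝 x, Orthonormal ℝ (fun i ↦ e i y) := heo
  have heo_x := heo.self_of_nhds
  let s : SmoothField I M → SmoothField I M → SmoothFun I M :=
    fun Y Z ↦ ∑ i, L.metric (L.curv (e i) Y Z) (e i)
  have hs : ∀ Y Z : SmoothField I M, ⇑(smoothRicci I M Y Z) =ᶠ[𝓝 x] ⇑(s Y Z) := by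
    intro Y Z
    filter_upwards [heo] with y hy
    rw [smoothRicci_apply, ricci_eq_sum Z.contMDiff (fun i ↦ (e i).mdifferentiableAt) hy]
    simp only [s, smoothFun_sum_apply, smoothLeviCivita_metric_apply, L, coe_smoothLeviCivita_curv]
  have hsum : L.lie ξ (smoothRicci I M) Y Z x
      = ∑ i, L.lie ξ (fun Y Z ↦ L.metric (L.curv (e i) Y Z) (e i)) Y Z x := by
    simp only [L, lie_apply, der_congr_of_eventuallyEq ξ (hs Y Z), (hs _ _).self_of_nhds]
    simp only [s, map_sum, smoothFun_sum_apply, Finset.sum_sub_distrib, L]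
  let T := TensorialAt.mkHom (fun U ↦ curvature U Y Z x) x (curvature_tensorialAt Y Z.contMDiff x)
  have hT : ∀ U : SmoothField I M, L.curv U Y Z x = T (U x) := fun U ↦ by
    rw [coe_smoothLeviCivita_curv]
    exact (TensorialAt.mkHom_apply (curvature_tensorialAt Y Z.contMDiff x)
      U.mdifferentiableAt).symm
  have hskew := sum_inner_skew_horizontal (frameBasis heo_x)
    (T : TangentSpace I x →ₗ[ℝ] TangentSpace I x) (a := fun i ↦ L.bracket ξ (e i) x) (ξ x) (by
      intro i j
      have h := DFunLike.congr_fun (hξ.lie_metric (e i) (e j)) x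
      have hd : L.der ξ (L.metric (e i) (e j)) x = 0 := by
        have : ⇑(L.metric (e i) (e j))
            =ᶠ[𝓝 x] ⇑(algebraMap ℝ (SmoothFun I M) (if i = j then 1 else 0)) := by
          filter_upwards [heo] with y hy
          exact orthonormal_iff_ite.1 hy i j
        rw [der_congr_of_eventuallyEq ξ this, Derivation.map_algebraMap]
        rfl
      rw [lie_apply, hd] at h
      simp only [ContMDiffMap.coe_mul, Pi.mul_apply, smoothFun_two_apply, horiz_apply,
        smoothLeviCivita_metric_apply] at h
      simp only [coe_frameBasis, L]
      linarith)
  have hterm : ∀ i, L.lie ξ (fun Y Z ↦ L.metric (L.curv (e i) Y Z) (e i)) Y Z x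
      = (2 * (inner ℝ (T (e i x)) (e i x) - inner ℝ (T (e i x)) (ξ x) * inner ℝ (e i x) (ξ x))
        + inner ℝ (T (L.bracket ξ (e i) x)) (e i x) + inner ℝ (T (e i x)) (L.bracket ξ (e i) x))
        - 2 * (L.horiz ξ Y Z x - (inner ℝ (Y x) (e i x) * inner ℝ (e i x) (Z x)
          - inner ℝ (Y x) (e i x) * inner ℝ (e i x) (ξ x) * inner ℝ (Z x) (ξ x))) := by
    intro i
    have h := DFunLike.congr_fun (hξ.lie_metric_curv (e i) Y Z) x
    rw [h, ← hT, ← hT]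
    have hu : inner ℝ (e i x) (e i x) = (1 : ℝ) := by
      rw [real_inner_self_eq_norm_sq, heo_x.1 i]; norm_num
    simp only [ContMDiffMap.coe_mul, ContMDiffMap.coe_add, ContMDiffMap.coe_sub, Pi.add_apply,
      Pi.sub_apply, Pi.mul_apply, smoothFun_two_apply, horiz_apply, smoothLeviCivita_metric_apply,
      hu, L]
    ring
  have h₂ := (frameBasis heo_x).sum_inner_mul_inner (Y x) (Z x)
  have h₃ := (frameBasis heo_x).sum_inner_mul_inner (Y x) (ξ x)
  simp only [coe_frameBasis, ContinuousLinearMap.coe_coe] at h₂ h₃ hskew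
  rw [hsum]
  simp only [hterm]
  rw [Finset.sum_sub_distrib, hskew, ← Finset.mul_sum, Finset.sum_sub_distrib,
    Finset.sum_sub_distrib, h₂, ← Finset.sum_mul, h₃]
  simp only [ContMDiffMap.coe_mul, ContMDiffMap.coe_neg, Pi.neg_apply, Pi.mul_apply,
    smoothFun_two_apply, smoothFun_algebraMap_apply, horiz_apply, Finset.sum_const,
    Finset.card_univ, Fintype.card_fin, nsmul_eq_mul, L]
  ring

variable {φ : Π x : M, TangentSpace I x →L[ℝ] TangentSpace I x} {ξ : Π x : M, TangentSpace I x}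
  {η : Π x : M, TangentSpace I x →L[ℝ] ℝ}

lemma IsAlmostContactMetric.inner_xi (h : IsAlmostContactMetric φ ξ η) (x : M) :
    inner ℝ (ξ x) (ξ x) = (1 : ℝ) := by
  rw [← h.eta_eq, h.eta_xi]

lemma IsAlmostContactMetric.phi_xi (h : IsAlmostContactMetric φ ξ η) (x : M) : φ x (ξ x) = 0 := by
  have := h.inner_phi x (ξ x) (ξ x)
  rw [h.eta_xi, h.inner_xi] at this
  exact inner_self_eq_zero.1 (this.trans (by norm_num))

lemma IsAlmostContactMetric.eta_phi (h : IsAlmostContactMetric φ ξ η) (x : M)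
    (v : TangentSpace I x) : η x (φ x v) = 0 := by
  have h₁ := h.phi_sq x (φ x v)
  rw [h.phi_sq x v, map_add, map_neg, map_smul, h.phi_xi, smul_zero, add_zero, left_eq_add] at h₁
  have h₂ := congrArg (η x) h₁
  simpa [h.eta_xi] using h₂

/-- On a Kenmotsu manifold, `∇_X ξ = X - η(X)ξ`. -/
lemma IsKenmotsu.nabla_xi (h : IsKenmotsu φ ξ η) {X : Π x : M, TangentSpace I x}
    (hX : CMDiff ∞ (T% X)) (x : M) :
    nabla X ξ x = X x - (inner ℝ (X x) (ξ x) : ℝ) • ξ x := by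
  have hξ := h.xi_smooth
  have h₀ : η x (nabla X ξ x) = 0 := by
    have h₁ := leviCivita_metric (mdiffAt_section_of_contMDiff hX x)
      (mdiffAt_section_of_contMDiff hξ x) (mdiffAt_section_of_contMDiff hξ x)
    simp only [h.inner_xi, mvfderiv_const] at h₁
    rw [real_inner_comm] at h₁
    rw [h.eta_eq, nabla, real_inner_comm]
    have h₂ : (0 : ℝ) = _ := h₁
    linarith
  have h₁ := h.nabla_phi X ξ hX hξ x
  have h₂ : (fun y ↦ φ y (ξ y)) = (0 : Π x : M, TangentSpace I x) := funext h.phi_xi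
  have h₃ : nabla X (0 : Π x : M, TangentSpace I x) x = 0 := by simp [nabla]
  rw [h₂, h₃, ← h.eta_eq, h.eta_phi, h.eta_xi, zero_smul, one_smul, zero_sub, zero_sub,
    neg_inj] at h₁
  have h₄ := congrArg (φ x) h₁
  rw [h.phi_sq, h.phi_sq, h₀, zero_smul, add_zero, h.eta_eq] at h₄
  rw [← neg_inj, h₄]
  module

/-- The field `ξ` of a Kenmotsu manifold is a Kenmotsu field in the algebraic sense. -/
lemma IsKenmotsu.isKenmotsuField (h : IsKenmotsu φ ξ η) :
    (smoothLeviCivita I M).IsKenmotsuField ⟨ξ, h.xi_smooth⟩ where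
  unit := by ext x; exact h.inner_xi x
  conn_eq X := by ext x; exact h.nabla_xi X.contMDiff x

/-- On a Kenmotsu manifold of dimension greater than `1`, the constants of a conformal `η`-Ricci
soliton satisfy `λ + μ = dim M - 1 + (p / 2 + 1 / dim M)`. -/
theorem IsConformalEtaRicciSoliton.lam_add_mu [Nonempty M] (h : IsKenmotsu φ ξ η)
    (hE : 1 < Module.finrank ℝ E) {V : Π x : M, TangentSpace I x} {lam mu p : ℝ}
    (hsol : IsConformalEtaRicciSoliton η V lam mu p) :
    lam + mu = Module.finrank ℝ E - 1 + (p / 2 + 1 / (Module.finrank ℝ E : ℝ)) := by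
  let c : ℝ →+* SmoothFun I M := algebraMap ℝ (SmoothFun I M)
  have hc : ∀ (r : ℝ) X, (smoothLeviCivita I M).der X (c r) = 0 := fun r X ↦
    Derivation.map_algebraMap _ r
  have key := h.isKenmotsuField.soliton_const_mul_horiz
    (V := ⟨V, hsol.smooth⟩) (S := smoothRicci I M) (N := c (Module.finrank ℝ E - 1))
    (a := c (lam - (p + 2 / (Module.finrank ℝ E : ℝ)) / 2)) (b := c mu) (hc _) (hc _) (hc _)
    (fun X Y ↦ by
      ext x
      have hx := hsol.equation X Y X.contMDiff Y.contMDiff x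
      rw [h.eta_eq, h.eta_eq] at hx
      have hlie : (smoothLeviCivita I M).lie ⟨V, hsol.smooth⟩
          (fun X Y ↦ (smoothLeviCivita I M).metric X Y) X Y x = lieDerivMetric V X Y x := by
        rw [lie_apply, smoothLeviCivita_metric_apply, smoothLeviCivita_metric_apply,
          coe_smoothLeviCivita_bracket, coe_smoothLeviCivita_bracket]
        rfl
      have hm : ∀ Z : SmoothField I M, (smoothLeviCivita I M).metric Z ⟨ξ, h.xi_smooth⟩ x
        = inner ℝ (Z x) (ξ x) := fun _ ↦ rfl
      simp only [ContMDiffMap.coe_mul, ContMDiffMap.coe_add, Pi.add_apply, Pi.mul_apply,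
        smoothFun_two_apply, hlie, smoothLeviCivita_metric_apply X Y, hm, smoothRicci_apply, c,
        smoothFun_algebraMap_apply, ContMDiffMap.coe_zero, Pi.zero_apply]
      linear_combination hx)
    (smoothRicci_field h.isKenmotsuField) (lie_smoothRicci h.isKenmotsuField)
  obtain ⟨x⟩ := ‹Nonempty M›
  obtain ⟨e, he, heo⟩ := exists_orthonormal_frame (I := I) x
  have heo := heo.self_of_nhds
  have key' : ∀ i, (Module.finrank ℝ E - 1 - (lam - (p + 2 / (Module.finrank ℝ E : ℝ)) / 2) - mu)
      * (1 - inner ℝ (ξ x) (e i x) * inner ℝ (e i x) (ξ x)) = 0 := by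
    intro i
    have hi := DFunLike.congr_fun (key ⟨e i, he i⟩ ⟨e i, he i⟩) x
    simp only [ContMDiffMap.coe_mul, ContMDiffMap.coe_sub, Pi.sub_apply, Pi.mul_apply,
      horiz_apply, c, smoothFun_algebraMap_apply, ContMDiffMap.coe_zero, Pi.zero_apply] at hi
    have hu : inner ℝ (e i x) (e i x) = (1 : ℝ) := by
      rw [real_inner_self_eq_norm_sq, heo.1 i]; norm_num
    have hi' : _ * (inner ℝ (e i x) (e i x) - inner ℝ (e i x) (ξ x) * inner ℝ (e i x) (ξ x))
      = (0 : ℝ) := hi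
    rw [hu] at hi'
    rw [real_inner_comm (e i x) (ξ x)]
    exact hi'
  have hsum := (frameBasis heo).sum_inner_mul_inner (ξ x) (ξ x)
  simp only [coe_frameBasis, h.inner_xi] at hsum
  have htot := Finset.sum_eq_zero fun i (_ : i ∈ Finset.univ) ↦ key' i
  rw [← Finset.mul_sum, Finset.sum_sub_distrib, hsum] at htot
  have hE' : (1 : ℝ) < Module.finrank ℝ E := by exact_mod_cast hE
  have hne : (∑ _i : Fin (Module.finrank ℝ E), (1 : ℝ)) - 1 ≠ 0 := by
    simp only [Finset.sum_const, Finset.card_univ, Fintype.card_fin, nsmul_eq_mul, mul_one]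
    linarith
  have := (mul_eq_zero.1 htot).resolve_right hne
  linear_combination -this

end RiemannianGeometry

end

open Bundle RiemannianGeometry
open scoped Manifold ContDiff

theorem conformal_eta_ricci_soliton_shrinking_steady_expanding
    (n : ℕ) (hn : 1 ≤ n)
    {M : Type*} [TopologicalSpace M] [T2Space M] [Nonempty M]
    [ChartedSpace (EuclideanSpace ℝ (Fin (2 * n + 1))) M]
    [IsManifold (𝓡 (2 * n + 1)) ∞ M]
    [RiemannianBundle (fun x : M ↦ TangentSpace (𝓡 (2 * n + 1)) x)]
    [IsContMDiffRiemannianBundle (𝓡 (2 * n + 1)) ∞ (EuclideanSpace ℝ (Fin (2 * n + 1)))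
      (fun x : M ↦ TangentSpace (𝓡 (2 * n + 1)) x)]
    (φ : Π x : M, TangentSpace (𝓡 (2 * n + 1)) x →L[ℝ] TangentSpace (𝓡 (2 * n + 1)) x)
    (ξ : Π x : M, TangentSpace (𝓡 (2 * n + 1)) x)
    (η : Π x : M, TangentSpace (𝓡 (2 * n + 1)) x →L[ℝ] ℝ)
    (hK : IsKenmotsu φ ξ η)
    (V : Π x : M, TangentSpace (𝓡 (2 * n + 1)) x) (lam mu p : ℝ)
    (hsol : IsConformalEtaRicciSoliton η V lam mu p) :
    lam + mu = 2 * (n : ℝ) + (p / 2 + 1 / (2 * (n : ℝ) + 1)) ∧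
      (mu < 2 * (n : ℝ) + (p / 2 + 1 / (2 * (n : ℝ) + 1)) → 0 < lam) ∧
      (mu = 2 * (n : ℝ) + (p / 2 + 1 / (2 * (n : ℝ) + 1)) → lam = 0) ∧
      (2 * (n : ℝ) + (p / 2 + 1 / (2 * (n : ℝ) + 1)) < mu → lam < 0) := by

  have hdim : Module.finrank ℝ (EuclideanSpace ℝ (Fin (2 * n + 1))) = 2 * n + 1 := by simp
  have h := hsol.lam_add_mu hK (by rw [hdim]; lia)
  rw [hdim] at h
  push_cast at h
  have h' : lam + mu = 2 * (n : ℝ) + (p / 2 + 1 / (2 * (n : ℝ) + 1)) := by linarith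
  exact ⟨h', fun _ ↦ by linarith, fun _ ↦ by linarith, fun _ ↦ by linarith⟩
end

section
/- Let $n \ge 0$ and let $(M, g)$ be a smooth (Hausdorff) Riemannian manifold of dimension $2n+1$ with Levi-Civita connection $\nabla$, curvature tensor $R(X,Y)Z = \nabla_X\nabla_Y Z - \nabla_Y\nabla_X Z - \nabla_{[X,Y]}Z$, Ricci tensor $S(Y,Z) = \operatorname{tr}\,(X \mapsto R(X,Y)Z)$, and Ricci operator $Q$ defined by $g(QX,Y) = S(X,Y)$. Let $\phi$ be a smooth $(1,1)$-tensor field, $\xi$ a smooth vector field and $\eta$ a smooth $1$-form on $M$ such that $(M,g,\phi,\xi,\eta)$ is a Kenmotsu manifold, i.e. for all smooth vector fields $X, Y$, $$\phi^2 X = -X + \eta(X)\xi, \quad \eta(\xi) = 1, \quad \eta(X) = g(X,\xi), \quad g(\phi X,\phi Y) = g(X,Y) - \eta(X)\eta(Y),$$ $$(\nabla_X\phi)Y = g(\phi X, Y)\xi - \eta(Y)\phi X.$$ Let $(g, V, \lambda, \mu)$ be a conformal $\eta$-Ricci soliton on $M$, i.e. $V$ is a smooth vector field and $\lambda, \mu,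 p$ are real constants ($p$ being the conformal pressure) with $$\mathcal{L}_V g + 2S + \Big[2\lambda - \Big(p + \frac{2}{2n+1}\Big)\Big] g + 2\mu\, \eta\otimes\eta = 0.$$ Then the Lie derivative of the connection along $V$, $(\mathcal{L}_V\nabla)(X,Y) = [V,\nabla_X Y] - \nabla_{[V,X]}Y - \nabla_X[V,Y]$, satisfies $$(\mathcal{L}_V\nabla)(X,\xi) = 2QX + 4nX$$ for every smooth vector field $X$ on $M$. -/
open Bundle VectorField
open scoped Manifold ContDiff

set_option linter.unusedSectionVars false

noncomputable section

namespace Kenmotsu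

section Connection

variable {E : Type*} [NormedAddCommGroup E] [NormedSpace ℝ E]
  {H : Type*} [TopologicalSpace H] {I : ModelWithCorners ℝ E H}
  {M : Type*} [TopologicalSpace M] [ChartedSpace H M] [IsManifold I ∞ M]

/-- `X` is a smooth vector field on `M`. -/
def IsSmoothField (X : Π x : M, TangentSpace I x) : Prop :=
  CMDiff ∞ (T% X)

/-- The vector field `∇_X Y`. -/
def nabla (cov : CovariantDerivative I E (TangentSpace I : M → Type _))
    (X Y : Π x : M, TangentSpace I x) : Π x : M, TangentSpace I x :=
  fun x ↦ cov Y x (X x)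

/-- The Riemann curvature `R(X, Y)Z = ∇_X ∇_Y Z - ∇_Y ∇_X Z - ∇_[X, Y] Z`. -/
def curvature (cov : CovariantDerivative I E (TangentSpace I : M → Type _))
    (X Y Z : Π x : M, TangentSpace I x) : Π x : M, TangentSpace I x :=
  nabla cov X (nabla cov Y Z) - nabla cov Y (nabla cov X Z)
    - nabla cov (mlieBracket I X Y) Z

/-- The Lie derivative of a connection along `V`:
`(L_V ∇)(X, Y) = [V, ∇_X Y] - ∇_[V, X] Y - ∇_X [V, Y]`. -/
def lieConnection (cov : CovariantDerivative I E (TangentSpace I : M → Type _))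
    (V X Y : Π x : M, TangentSpace I x) : Π x : M, TangentSpace I x :=
  mlieBracket I V (nabla cov X Y) - nabla cov (mlieBracket I V X) Y
    - nabla cov X (mlieBracket I V Y)

end Connection

section Curvature

variable {E : Type*} [NormedAddCommGroup E] [NormedSpace ℝ E] [FiniteDimensional ℝ E]
  {H : Type*} [TopologicalSpace H] {I : ModelWithCorners ℝ E H}
  {M : Type*} [TopologicalSpace M] [ChartedSpace H M] [IsManifold I ∞ M] [T2Space M]

/-- An extension of a tangent vector at `x` to a vector field on `M`: the field that is constant in
the preferred chart at `x`, multiplied by a smooth bump function at `x`. -/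
def extendField {x : M} (v : TangentSpace I x) : Π y : M, TangentSpace I y :=
  (Classical.arbitrary (SmoothBumpFunction I x) : M → ℝ) • FiberBundle.extend E v

theorem extendField_self {x : M} (v : TangentSpace I x) : extendField v x = v := by
  simp [extendField]

theorem isSmoothField_extendField {x : M} (v : TangentSpace I x) :
    IsSmoothField (extendField v) := by
  set t := trivializationAt E (TangentSpace I : M → Type _) x
  refine ContMDiffOn.smul_section_of_tsupport (u := t.baseSet)
    (SmoothBumpFunction.contMDiff _).contMDiffOn t.open_baseSet ?_ ?_
  · simpa [t] using
      (Classical.arbitrary (SmoothBumpFunction I x)).tsupport_subset_chartAt_source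
  · intro y hy
    rw [t.contMDiffWithinAt_section _ hy]
    have : CMDiff[t.baseSet] ∞ (fun _ : M ↦ (t ⟨x, v⟩).2) := contMDiffOn_const
    refine this.congr (fun z hz ↦ ?_) y hy
    change (t ⟨z, t.symm z (t ⟨x, v⟩).2⟩).2 = (t ⟨x, v⟩).2
    rw [t.apply_mk_symm hz]

theorem extendField_eq_zero {x : M} (v : TangentSpace I x) {y : M}
    (hy : y ∉ (trivializationAt E (TangentSpace I : M → Type _) x).baseSet) :
    extendField v y = 0 := by
  have h : (Classical.arbitrary (SmoothBumpFunction I x)) y = 0 := by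
    by_contra h
    exact hy (by simpa using SmoothBumpFunction.support_subset_source _ h)
  simp [extendField, h]

theorem extendField_add {x : M} (v w : TangentSpace I x) :
    extendField (v + w) = extendField v + extendField w := by
  set t := trivializationAt E (TangentSpace I : M → Type _) x
  have hx : x ∈ t.baseSet := FiberBundle.mem_baseSet_trivializationAt' x
  have h : (t ⟨x, v + w⟩).2 = (t ⟨x, v⟩).2 + (t ⟨x, w⟩).2 := (t.linear ℝ hx).map_add v w
  funext y
  by_cases hy : y ∈ t.baseSet
  · have h' := (t.symmₗ ℝ y).map_add (t ⟨x, v⟩).2 (t ⟨x, w⟩).2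
    rw [t.coe_symmₗ hy] at h'
    change (_ : ℝ) • t.symm y (t ⟨x, v + w⟩).2
      = (_ : ℝ) • t.symm y (t ⟨x, v⟩).2 + (_ : ℝ) • t.symm y (t ⟨x, w⟩).2
    rw [h, ← smul_add]
    exact congrArg _ h'
  · simp [extendField_eq_zero _ hy]

theorem extendField_smul {x : M} (c : ℝ) (v : TangentSpace I x) :
    extendField (c • v) = c • extendField v := by
  set t := trivializationAt E (TangentSpace I : M → Type _) x
  have hx : x ∈ t.baseSet := FiberBundle.mem_baseSet_trivializationAt' x
  have h : (t ⟨x, c • v⟩).2 = c • (t ⟨x, v⟩).2 := (t.linear ℝ hx).map_smul c v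
  funext y
  by_cases hy : y ∈ t.baseSet
  · have h' := (t.symmₗ ℝ y).map_smul c (t ⟨x, v⟩).2
    rw [t.coe_symmₗ hy] at h'
    change (_ : ℝ) • t.symm y (t ⟨x, c • v⟩).2 = c • ((_ : ℝ) • t.symm y (t ⟨x, v⟩).2)
    rw [h, smul_comm]
    exact congrArg _ h'
  · simp [extendField_eq_zero _ hy]

theorem IsSmoothField.mdiffAt {X : Π x : M, TangentSpace I x} (hX : IsSmoothField X) (x : M) :
    MDiffAt (T% X) x :=
  (hX x).mdifferentiableAt (by simp)

variable (cov : CovariantDerivative I E (TangentSpace I : M → Type _))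

theorem nabla_add_left (X X' Y : Π x : M, TangentSpace I x) :
    nabla cov (X + X') Y = nabla cov X Y + nabla cov X' Y := by
  funext x
  simp [nabla]

theorem nabla_smul_left (c : ℝ) (X Y : Π x : M, TangentSpace I x) :
    nabla cov (c • X) Y = c • nabla cov X Y := by
  funext x
  simp [nabla]

theorem nabla_add_right (X : Π x : M, TangentSpace I x) {Y Y' : Π x : M, TangentSpace I x}
    (hY : IsSmoothField Y) (hY' : IsSmoothField Y') :
    nabla cov X (Y + Y') = nabla cov X Y + nabla cov X Y' := by
  funext x
  simp [nabla, cov.isCovariantDerivativeOnUniv.add (hY.mdiffAt x) (hY'.mdiffAt x)]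

theorem nabla_smul_right (X : Π x : M, TangentSpace I x) (c : ℝ) {Y : Π x : M, TangentSpace I x}
    (hY : IsSmoothField Y) : nabla cov X (c • Y) = c • nabla cov X Y := by
  funext x
  simp [nabla, cov.isCovariantDerivativeOnUniv.smul_const c (hY.mdiffAt x)]

variable [hcov : cov.ContMDiffCovariantDerivative ∞]

theorem IsSmoothField.nabla {X Y : Π x : M, TangentSpace I x}
    (hX : IsSmoothField X) (hY : IsSmoothField Y) : IsSmoothField (nabla cov X Y) := by
  have h := hcov.contMDiff.contMDiff (σ := Y) (by simpa using hY.contMDiffOn)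
  rw [contMDiffOn_univ] at h
  exact ContMDiff.clm_bundle_apply h hX

theorem curvature_add₁ {X X' Y Z : Π x : M, TangentSpace I x} (hX : IsSmoothField X)
    (hX' : IsSmoothField X') (hZ : IsSmoothField Z) :
    curvature cov (X + X') Y Z = curvature cov X Y Z + curvature cov X' Y Z := by
  have hb : mlieBracket I (X + X') Y = mlieBracket I X Y + mlieBracket I X' Y := by
    funext x
    exact mlieBracket_add_left (hX.mdiffAt x) (hX'.mdiffAt x)
  simp only [curvature, hb, nabla_add_left, nabla_add_right cov Y (hX.nabla cov hZ)
    (hX'.nabla cov hZ)]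
  abel

theorem curvature_smul₁ (c : ℝ) {X Y Z : Π x : M, TangentSpace I x} (hX : IsSmoothField X)
    (hZ : IsSmoothField Z) :
    curvature cov (c • X) Y Z = c • curvature cov X Y Z := by
  have hb : mlieBracket I (c • X) Y = c • mlieBracket I X Y := by
    funext x
    exact mlieBracket_const_smul_left (hX.mdiffAt x)
  simp only [curvature, hb, nabla_smul_left, nabla_smul_right cov Y c (hX.nabla cov hZ), smul_sub]

theorem curvature_swap (X Y Z : Π x : M, TangentSpace I x) :
    curvature cov X Y Z = -curvature cov Y X Z := by
  have h : nabla cov (mlieBracket I X Y) Z = -nabla cov (mlieBracket I Y X) Z := by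
    rw [mlieBracket_swap]
    funext x
    simp [nabla]
  simp only [curvature, h]
  abel

theorem curvature_add₃ {X Y Z Z' : Π x : M, TangentSpace I x} (hX : IsSmoothField X)
    (hY : IsSmoothField Y) (hZ : IsSmoothField Z) (hZ' : IsSmoothField Z') :
    curvature cov X Y (Z + Z') = curvature cov X Y Z + curvature cov X Y Z' := by
  simp only [curvature, nabla_add_right cov _ hZ hZ',
    nabla_add_right cov _ (hX.nabla cov hZ) (hX.nabla cov hZ'),
    nabla_add_right cov _ (hY.nabla cov hZ) (hY.nabla cov hZ')]
  abel

theorem curvature_smul₃ (c : ℝ) {X Y Z : Π x : M, TangentSpace I x} (hX : IsSmoothField X)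
    (hY : IsSmoothField Y) (hZ : IsSmoothField Z) :
    curvature cov X Y (c • Z) = c • curvature cov X Y Z := by
  simp only [curvature, nabla_smul_right cov _ c hZ, nabla_smul_right cov _ c (hX.nabla cov hZ),
    nabla_smul_right cov _ c (hY.nabla cov hZ), smul_sub]

/-- For tangent vectors `v`, `w` at `x`, the endomorphism `u ↦ R(u, v)w` of the tangent space
at `x`. -/
def curvatureEnd (x : M) (v w : TangentSpace I x) : TangentSpace I x →ₗ[ℝ] TangentSpace I x where
  toFun u := curvature cov (extendField u) (extendField v) (extendField w) x
  map_add' u u' := by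
    rw [extendField_add, curvature_add₁ cov (isSmoothField_extendField u)
      (isSmoothField_extendField u') (isSmoothField_extendField w), Pi.add_apply]
  map_smul' c u := by
    rw [extendField_smul, curvature_smul₁ cov c (isSmoothField_extendField u)
      (isSmoothField_extendField w), Pi.smul_apply, RingHom.id_apply]

/-- The Ricci tensor `S(v, w) = tr (u ↦ R(u, v)w)`. -/
def ricci (x : M) : TangentSpace I x →ₗ[ℝ] TangentSpace I x →ₗ[ℝ] ℝ :=
  LinearMap.mk₂ ℝ (fun v w ↦ LinearMap.trace ℝ (TangentSpace I x) (curvatureEnd cov x v w))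
    (fun v v' w ↦ by
      rw [← map_add]
      congr 1
      ext u
      simp only [curvatureEnd, LinearMap.coe_mk, AddHom.coe_mk, LinearMap.add_apply,
        extendField_add]
      rw [curvature_swap, curvature_add₁ cov (isSmoothField_extendField v)
        (isSmoothField_extendField v') (isSmoothField_extendField w),
        curvature_swap cov (extendField u) (extendField v),
        curvature_swap cov (extendField u) (extendField v')]
      simp only [Pi.neg_apply, Pi.add_apply, neg_add])
    (fun c v w ↦ by
      rw [← map_smul]
      congr 1
      ext u
      simp only [curvatureEnd, LinearMap.coe_mk, AddHom.coe_mk, LinearMap.smul_apply,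
        extendField_smul]
      rw [curvature_swap, curvature_smul₁ cov c (isSmoothField_extendField v)
        (isSmoothField_extendField w), curvature_swap cov (extendField u) (extendField v)]
      simp only [Pi.neg_apply, Pi.smul_apply, smul_neg])
    (fun v w w' ↦ by
      rw [← map_add]
      congr 1
      ext u
      simp only [curvatureEnd, LinearMap.coe_mk, AddHom.coe_mk, LinearMap.add_apply,
        extendField_add]
      rw [curvature_add₃ cov (isSmoothField_extendField u) (isSmoothField_extendField v)
        (isSmoothField_extendField w) (isSmoothField_extendField w'), Pi.add_apply])
    (fun c v w ↦ by
      rw [← map_smul]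
      congr 1
      ext u
      simp only [curvatureEnd, LinearMap.coe_mk, AddHom.coe_mk, LinearMap.smul_apply,
        extendField_smul]
      rw [curvature_smul₃ cov c (isSmoothField_extendField u) (isSmoothField_extendField v)
        (isSmoothField_extendField w), Pi.smul_apply])

end Curvature

section Metric

variable {E : Type*} [NormedAddCommGroup E] [NormedSpace ℝ E] [FiniteDimensional ℝ E]
  {H : Type*} [TopologicalSpace H] {I : ModelWithCorners ℝ E H}
  {M : Type*} [TopologicalSpace M] [ChartedSpace H M] [IsManifold I ∞ M]
  [RiemannianBundle (fun x : M ↦ TangentSpace I x)]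

/-- `(L_V g)(X, Y) = V(g(X, Y)) - g([V, X], Y) - g(X, [V, Y])`. -/
def lieMetric (V X Y : Π x : M, TangentSpace I x) (x : M) : ℝ :=
  d% (fun y ↦ inner ℝ (X y) (Y y)) x (V x)
    - inner ℝ (mlieBracket I V X x) (Y x) - inner ℝ (X x) (mlieBracket I V Y x)

/-- `∇` is the Levi-Civita connection of the Riemannian metric: it is torsion-free and compatible
with the metric, `X(g(Y, Z)) = g(∇_X Y, Z) + g(Y, ∇_X Z)`. -/
structure IsLeviCivita (cov : CovariantDerivative I E (TangentSpace I : M → Type _)) : Prop where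
  torsion_eq_zero : cov.torsion = 0
  metric : ∀ X Y Z : Π x : M, TangentSpace I x,
    IsSmoothField X → IsSmoothField Y → IsSmoothField Z → ∀ x : M,
    d% (fun y ↦ inner ℝ (Y y) (Z y)) x (X x)
      = inner ℝ (nabla cov X Y x) (Z x) + inner ℝ (Y x) (nabla cov X Z x)

/-- The Ricci operator `Q`, characterized by `g(Qv, w) = S(v, w)`. -/
def ricciOperator [T2Space M] (cov : CovariantDerivative I E (TangentSpace I : M → Type _))
    [cov.ContMDiffCovariantDerivative ∞] (x : M) (v : TangentSpace I x) : TangentSpace I x :=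
  haveI : FiniteDimensional ℝ (TangentSpace I x) := inferInstanceAs (FiniteDimensional ℝ E)
  haveI : CompleteSpace (TangentSpace I x) := FiniteDimensional.complete ℝ _
  (InnerProductSpace.toDual ℝ (TangentSpace I x)).symm
    (LinearMap.toContinuousLinearMap (ricci cov x v))

theorem inner_ricciOperator [T2Space M]
    (cov : CovariantDerivative I E (TangentSpace I : M → Type _))
    [cov.ContMDiffCovariantDerivative ∞] (x : M) (v w : TangentSpace I x) :
    inner ℝ (ricciOperator cov x v) w = ricci cov x v w := by
  simp [ricciOperator]

/-- `(φ, ξ, η)` is an almost contact metric structure on the Riemannian manifold `M`. -/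
structure IsAlmostContactMetric (φ : Π x : M, TangentSpace I x →L[ℝ] TangentSpace I x)
    (ξ : Π x : M, TangentSpace I x) (η : Π x : M, TangentSpace I x →L[ℝ] ℝ) : Prop where
  smooth_φ : ContMDiff I (I.prod 𝓘(ℝ, E →L[ℝ] E)) ∞
    (fun x ↦ TotalSpace.mk' (E →L[ℝ] E)
      (E := fun y : M ↦ TangentSpace I y →L[ℝ] TangentSpace I y) x (φ x))
  smooth_ξ : IsSmoothField ξ
  smooth_η : ContMDiff I (I.prod 𝓘(ℝ, E →L[ℝ] ℝ)) ∞
    (fun x ↦ TotalSpace.mk' (E →L[ℝ] ℝ)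
      (E := fun y : M ↦ TangentSpace I y →L[ℝ] Bundle.Trivial M ℝ y) x (η x))
  φ_sq : ∀ (x : M) (v : TangentSpace I x), φ x (φ x v) = -v + η x v • ξ x
  η_ξ : ∀ x : M, η x (ξ x) = 1
  η_eq : ∀ (x : M) (v : TangentSpace I x), η x v = inner ℝ v (ξ x)
  inner_φ : ∀ (x : M) (v w : TangentSpace I x),
    inner ℝ (φ x v) (φ x w) = inner ℝ v w - η x v * η x w

/-- The Kenmotsu condition: `(φ, ξ, η)` is an almost contact metric structure with
`(∇_X φ)Y = g(φX, Y)ξ - η(Y)φX`, where `(∇_X φ)Y = ∇_X (φY) - φ(∇_X Y)`. -/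
structure IsKenmotsu (cov : CovariantDerivative I E (TangentSpace I : M → Type _))
    (φ : Π x : M, TangentSpace I x →L[ℝ] TangentSpace I x)
    (ξ : Π x : M, TangentSpace I x) (η : Π x : M, TangentSpace I x →L[ℝ] ℝ) : Prop
    extends IsAlmostContactMetric φ ξ η where
  nabla_φ : ∀ X Y : Π x : M, TangentSpace I x, IsSmoothField X → IsSmoothField Y → ∀ x : M,
    nabla cov X (fun y ↦ φ y (Y y)) x - φ x (nabla cov X Y x)
      = inner ℝ (φ x (X x)) (Y x) • ξ x - η x (Y x) • φ x (X x)

/-- `(g, V, λ, μ)` is a conformal `η`-Ricci soliton with conformal pressure `p`: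
`L_V g + 2S + [2λ - (p + 2/d)]g + 2μ η ⊗ η = 0`, where `d` is the dimension of `M`. -/
structure IsConformalEtaRicciSoliton [T2Space M]
    (cov : CovariantDerivative I E (TangentSpace I : M → Type _))
    [cov.ContMDiffCovariantDerivative ∞] (η : Π x : M, TangentSpace I x →L[ℝ] ℝ)
    (V : Π x : M, TangentSpace I x) (lam mu p : ℝ) : Prop where
  smooth_V : IsSmoothField V
  eq_zero : ∀ X Y : Π x : M, TangentSpace I x, IsSmoothField X → IsSmoothField Y → ∀ x : M,
    lieMetric V X Y x + 2 * ricci cov x (X x) (Y x)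
      + (2 * lam - (p + 2 / (Module.finrank ℝ E : ℝ))) * inner ℝ (X x) (Y x)
      + 2 * mu * (η x (X x) * η x (Y x)) = 0

end Metric

end Kenmotsu

end

namespace Kenmotsu

section SmoothFields

variable {E : Type*} [NormedAddCommGroup E] [NormedSpace ℝ E] [FiniteDimensional ℝ E]
  {H : Type*} [TopologicalSpace H] {I : ModelWithCorners ℝ E H}
  {M : Type*} [TopologicalSpace M] [ChartedSpace H M] [IsManifold I ∞ M] [T2Space M]
  {X Y Z W : Π x : M, TangentSpace I x}

namespace IsSmoothField

theorem zero : IsSmoothField (0 : Π x : M, TangentSpace I x) :=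
  contMDiff_zeroSection ℝ (TangentSpace I : M → Type _)

theorem neg (hX : IsSmoothField X) : IsSmoothField (-X) :=
  ContMDiff.neg_section hX

theorem sub (hX : IsSmoothField X) (hY : IsSmoothField Y) : IsSmoothField (X - Y) :=
  ContMDiff.sub_section hX hY

theorem smul {f : M → ℝ} (hf : CMDiff ∞ f) (hX : IsSmoothField X) : IsSmoothField (f • X) :=
  ContMDiff.smul_section hf hX

theorem mlieBracket (hX : IsSmoothField X) (hY : IsSmoothField Y) :
    IsSmoothField (mlieBracket I X Y) := by
  have : IsManifold I (minSmoothness ℝ 2) M := by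
    simp only [minSmoothness_of_isRCLikeNormedField]
    infer_instance
  have : IsManifold I (((⊤ : ℕ∞) : WithTop ℕ∞) + 1) M := inferInstanceAs (IsManifold I ∞ M)
  exact ContDiff.mlieBracket_vectorField (n := ⊤) (m := ⊤) hX hY (by simp)

end IsSmoothField

theorem mlieBracket_jacobi (hX : IsSmoothField X) (hY : IsSmoothField Y) (hZ : IsSmoothField Z) :
    mlieBracket I X (mlieBracket I Y Z) =
      mlieBracket I (mlieBracket I X Y) Z + mlieBracket I Y (mlieBracket I X Z) := by
  have : IsManifold I (minSmoothness ℝ 3) M := by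
    simp only [minSmoothness_of_isRCLikeNormedField]
    infer_instance
  have h2 : minSmoothness ℝ 2 ≤ ∞ := by
    simpa only [minSmoothness_of_isRCLikeNormedField] using ENat.LEInfty.out
  exact leibniz_identity_mlieBracket (hX.of_le h2) (hY.of_le h2) (hZ.of_le h2)

theorem mlieBracket_field_sub_right (hY : IsSmoothField Y) (hZ : IsSmoothField Z) :
    mlieBracket I X (Y - Z) = mlieBracket I X Y - mlieBracket I X Z := by
  have h : mlieBracket I X (-Z) = -mlieBracket I X Z := by
    funext x
    simpa using mlieBracket_const_smul_right (c := (-1 : ℝ)) (V := X) (hZ.mdiffAt x)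
  rw [sub_eq_add_neg, sub_eq_add_neg, ← h]
  funext x
  exact mlieBracket_add_right (hY.mdiffAt x) (hZ.neg.mdiffAt x)

theorem mlieBracket_cyclic (hX : IsSmoothField X) (hY : IsSmoothField Y) (hZ : IsSmoothField Z) :
    mlieBracket I X (mlieBracket I Y Z) + mlieBracket I Y (mlieBracket I Z X)
      + mlieBracket I Z (mlieBracket I X Y) = 0 := by
  have h : mlieBracket I Y (mlieBracket I X Z) = -mlieBracket I Y (mlieBracket I Z X) := by
    rw [mlieBracket_swap (V := X)]
    simpa using mlieBracket_field_sub_right (X := Y) IsSmoothField.zero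
      (hZ.mlieBracket hX)
  rw [mlieBracket_jacobi hX hY hZ, h, mlieBracket_swap (V := mlieBracket I X Y)]
  abel

theorem mlieBracket_fun_smul_right {f : M → ℝ} (hf : CMDiff ∞ f) (hY : IsSmoothField Y) :
    mlieBracket I X (f • Y) = (fun x ↦ d% f x (X x)) • Y + f • mlieBracket I X Y := by
  funext x
  exact mlieBracket_smul_right ((hf x).mdifferentiableAt (by simp)) (hY.mdiffAt x)

/-- `[X, Y]f = X(Yf) - Y(Xf)`. -/
theorem mvfderiv_mlieBracket {f : M → ℝ} (hf : CMDiff ∞ f) (hX : IsSmoothField X)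
    (hY : IsSmoothField Y) (hXf : CMDiff ∞ (fun y ↦ d% f y (X y)))
    (hYf : CMDiff ∞ (fun y ↦ d% f y (Y y))) (x : M) :
    d% f x (mlieBracket I X Y x) =
      d% (fun y ↦ d% f y (Y y)) x (X x) - d% (fun y ↦ d% f y (X y)) x (Y x) := by
  rcases subsingleton_or_nontrivial E with hE | hE
  · have h : ∀ v : TangentSpace I x, v = 0 := fun v ↦ hE.elim v (0 : E)
    rw [h (mlieBracket I X Y x), h (X x), h (Y x)]
    simp
  obtain ⟨v, hv⟩ := exists_ne (0 : E)
  set Z : Π y : M, TangentSpace I y := extendField (x := x) v with hZd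
  have hZ : IsSmoothField Z := isSmoothField_extendField _
  have hZx : Z x = v := extendField_self _
  have key := congrFun (mlieBracket_jacobi hX hY (IsSmoothField.smul hf hZ)) x
  rw [mlieBracket_fun_smul_right hf hZ, mlieBracket_fun_smul_right hf hZ,
    mlieBracket_fun_smul_right hf hZ, Pi.add_apply,
    mlieBracket_add_right ((IsSmoothField.smul hYf hZ).mdiffAt x)
      ((IsSmoothField.smul hf (hY.mlieBracket hZ)).mdiffAt x),
    mlieBracket_add_right ((IsSmoothField.smul hXf hZ).mdiffAt x)
      ((IsSmoothField.smul hf (hX.mlieBracket hZ)).mdiffAt x),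
    mlieBracket_fun_smul_right hYf hZ, mlieBracket_fun_smul_right hXf hZ,
    mlieBracket_fun_smul_right hf (hY.mlieBracket hZ),
    mlieBracket_fun_smul_right hf (hX.mlieBracket hZ), mlieBracket_jacobi hX hY hZ] at key
  simp only [Pi.add_apply, Pi.smul_apply', smul_add] at key
  have h0 : (d% (fun y ↦ d% f y (Y y)) x (X x) - d% (fun y ↦ d% f y (X y)) x (Y x)
      - d% f x (mlieBracket I X Y x)) • Z x = 0 := by
    rw [← sub_eq_zero.2 key]
    module
  rw [smul_eq_zero, hZx] at h0
  rcases h0 with h0 | h0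
  · linarith
  · exact absurd h0 hv

end SmoothFields

section Connection

variable {E : Type*} [NormedAddCommGroup E] [NormedSpace ℝ E] [FiniteDimensional ℝ E]
  {H : Type*} [TopologicalSpace H] {I : ModelWithCorners ℝ E H}
  {M : Type*} [TopologicalSpace M] [ChartedSpace H M] [IsManifold I ∞ M] [T2Space M]
  (cov : CovariantDerivative I E (TangentSpace I : M → Type _))
  {X Y Z W U : Π x : M, TangentSpace I x}

theorem nabla_fun_smul_left (f : M → ℝ) : nabla cov (f • X) Y = f • nabla cov X Y := by
  funext x
  simp [nabla]

theorem nabla_neg_right (hY : IsSmoothField Y) : nabla cov X (-Y) = -nabla cov X Y := by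
  simpa using nabla_smul_right cov X (-1) hY

theorem nabla_sub_right (hY : IsSmoothField Y) (hZ : IsSmoothField Z) :
    nabla cov X (Y - Z) = nabla cov X Y - nabla cov X Z := by
  rw [sub_eq_add_neg, nabla_add_right cov X hY hZ.neg, nabla_neg_right cov hZ, sub_eq_add_neg]

theorem nabla_fun_smul_right {f : M → ℝ} (hf : CMDiff ∞ f) (hY : IsSmoothField Y) :
    nabla cov X (f • Y) = (fun x ↦ d% f x (X x)) • Y + f • nabla cov X Y := by
  funext x
  have h := cov.isCovariantDerivativeOnUniv.leibniz (hY.mdiffAt x)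
    ((hf x).mdifferentiableAt (by simp))
  simp [nabla, h, add_comm]

/-- The connection is torsion-free on smooth fields. -/
theorem nabla_sub_nabla_eq_mlieBracket (hcov : cov.torsion = 0) (hX : IsSmoothField X)
    (hY : IsSmoothField Y) : nabla cov X Y - nabla cov Y X = mlieBracket I X Y := by
  funext x
  exact cov.torsion_eq_zero_iff.1 hcov (hX.mdiffAt x) (hY.mdiffAt x)

end Connection

section Curvature

variable {E : Type*} [NormedAddCommGroup E] [NormedSpace ℝ E] [FiniteDimensional ℝ E]
  {H : Type*} [TopologicalSpace H] {I : ModelWithCorners ℝ E H}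
  {M : Type*} [TopologicalSpace M] [ChartedSpace H M] [IsManifold I ∞ M] [T2Space M]
  (cov : CovariantDerivative I E (TangentSpace I : M → Type _))
  [hsm : cov.ContMDiffCovariantDerivative ∞]
  {X Y Z W : Π x : M, TangentSpace I x}

theorem IsSmoothField.curvature (hX : IsSmoothField X) (hY : IsSmoothField Y)
    (hZ : IsSmoothField Z) : IsSmoothField (curvature cov X Y Z) :=
  ((hX.nabla cov (hY.nabla cov hZ)).sub (hY.nabla cov (hX.nabla cov hZ))).sub
    ((hX.mlieBracket hY).nabla cov hZ)

theorem tensorialAt_curvature₁ (hZ : IsSmoothField Z) (x : M) :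
    TensorialAt I E (fun X ↦ curvature cov X Y Z x) x := by
  have hd : ∀ {X : Π x : M, TangentSpace I x}, MDiffAt (T% X) x →
      MDiffAt (T% (nabla cov X Z)) x := by
    intro X hX
    have h := hsm.contMDiff.contMDiff (σ := Z) (by simpa using hZ.contMDiffOn)
    rw [contMDiffOn_univ] at h
    exact MDifferentiableAt.clm_bundle_apply ((h x).mdifferentiableAt (by simp)) hX
  constructor
  · intro f X hf hX
    have h := cov.isCovariantDerivativeOnUniv.leibniz (hd hX) hf
    simp only [curvature, nabla_fun_smul_left, Pi.sub_apply, Pi.smul_apply']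
    simp only [nabla, mlieBracket_smul_left hf hX, map_add, map_smul]
    change _ - cov (f • nabla cov X Z) x (Y x) - _ = _
    rw [h]
    simp [nabla]
    module
  · intro X X' hX hX'
    have h := cov.isCovariantDerivativeOnUniv.add (hd hX) (hd hX')
    simp only [curvature, nabla_add_left, Pi.sub_apply, Pi.add_apply]
    simp only [nabla, mlieBracket_add_left hX hX', map_add]
    change _ - cov (nabla cov X Z + nabla cov X' Z) x (Y x) - _ = _
    rw [h]
    simp only [add_apply]
    module

/-- The first Bianchi identity. -/
theorem curvature_cyclic (hcov : cov.torsion = 0) (hX : IsSmoothField X) (hY : IsSmoothField Y)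
    (hZ : IsSmoothField Z) :
    curvature cov X Y Z + curvature cov Y Z X + curvature cov Z X Y = 0 := by
  have t {X Y : Π x : M, TangentSpace I x} (hX : IsSmoothField X) (hY : IsSmoothField Y) :=
    nabla_sub_nabla_eq_mlieBracket cov hcov hX hY
  have e {X Y Z : Π x : M, TangentSpace I x} (hX : IsSmoothField X) (hY : IsSmoothField Y)
      (hZ : IsSmoothField Z) : nabla cov X (nabla cov Y Z) - nabla cov X (nabla cov Z Y)
        - nabla cov (mlieBracket I Y Z) X = mlieBracket I X (mlieBracket I Y Z) := by
    rw [← nabla_sub_right cov (hY.nabla cov hZ) (hZ.nabla cov hY), t hY hZ,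
      t hX (hY.mlieBracket hZ)]
  rw [← mlieBracket_cyclic hX hY hZ, ← e hX hY hZ, ← e hY hZ hX, ← e hZ hX hY]
  simp only [curvature]
  abel

theorem curvature_eq_neg_sub (hcov : cov.torsion = 0) (hX : IsSmoothField X)
    (hY : IsSmoothField Y) (hZ : IsSmoothField Z) :
    curvature cov X Y Z = -curvature cov Y Z X - curvature cov Z X Y := by
  have h := curvature_cyclic cov hcov hX hY hZ
  rw [← sub_eq_zero, ← h]
  abel

/-- The curvature at a point depends only on the values of the fields at that point. -/
theorem curvature_congr (hcov : cov.torsion = 0) {X' Y' Z' : Π x : M, TangentSpace I x}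
    (hX : IsSmoothField X) (hY : IsSmoothField Y) (hZ : IsSmoothField Z)
    (hX' : IsSmoothField X') (hY' : IsSmoothField Y') (hZ' : IsSmoothField Z')
    {x : M} (hXx : X x = X' x) (hYx : Y x = Y' x) (hZx : Z x = Z' x) :
    curvature cov X Y Z x = curvature cov X' Y' Z' x := by
  have h₁ {X X' Y Z : Π x : M, TangentSpace I x} (hX : IsSmoothField X) (hX' : IsSmoothField X')
      (hY : IsSmoothField Y) (hZ : IsSmoothField Z) (hx : X x = X' x) :
      curvature cov X Y Z x = curvature cov X' Y Z x :=
    (tensorialAt_curvature₁ cov hZ x).pointwise (hX.mdiffAt x) (hX'.mdiffAt x) hx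
  have h₂ {X Y Y' Z : Π x : M, TangentSpace I x} (hX : IsSmoothField X) (hY : IsSmoothField Y)
      (hY' : IsSmoothField Y') (hZ : IsSmoothField Z) (hx : Y x = Y' x) :
      curvature cov X Y Z x = curvature cov X Y' Z x := by
    rw [curvature_swap cov X Y, curvature_swap cov X Y', Pi.neg_apply, Pi.neg_apply,
      h₁ hY hY' hX hZ hx]
  rw [h₁ hX hX' hY hZ hXx, h₂ hX' hY hY' hZ hYx, curvature_eq_neg_sub cov hcov hX' hY' hZ,
    curvature_eq_neg_sub cov hcov hX' hY' hZ', Pi.sub_apply, Pi.sub_apply, Pi.neg_apply,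
    Pi.neg_apply, h₂ hY' hZ hZ' hX' hZx, h₁ hZ hZ' hX' hY' hZx]

theorem curvatureEnd_apply (hcov : cov.torsion = 0) (hX : IsSmoothField X)
    (hY : IsSmoothField Y) (hZ : IsSmoothField Z) (x : M) :
    curvatureEnd cov x (Y x) (Z x) (X x) = curvature cov X Y Z x :=
  curvature_congr cov hcov (isSmoothField_extendField _) (isSmoothField_extendField _)
    (isSmoothField_extendField _) hX hY hZ (extendField_self _) (extendField_self _)
    (extendField_self _)

/-- The covariant derivative of the curvature tensor, `(∇_U R)(X, Y)Z`. -/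
noncomputable def nablaCurvature (U X Y Z : Π x : M, TangentSpace I x) :
    Π x : M, TangentSpace I x :=
  nabla cov U (curvature cov X Y Z) - curvature cov (nabla cov U X) Y Z
    - curvature cov X (nabla cov U Y) Z - curvature cov X Y (nabla cov U Z)

theorem curvature_sub₁ (hX : IsSmoothField X) (hY : IsSmoothField Y) (hW : IsSmoothField W) :
    curvature cov (X - Y) Z W = curvature cov X Z W - curvature cov Y Z W := by
  have h := curvature_smul₁ cov (-1) (Y := Z) hY hW
  simp only [neg_smul, one_smul] at h
  rw [sub_eq_add_neg, curvature_add₁ cov hX hY.neg hW, h, sub_eq_add_neg]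

/-- The second Bianchi identity. -/
theorem nablaCurvature_cyclic (hcov : cov.torsion = 0) (hX : IsSmoothField X)
    (hY : IsSmoothField Y) (hZ : IsSmoothField Z) (hW : IsSmoothField W) :
    nablaCurvature cov X Y Z W + nablaCurvature cov Y Z X W + nablaCurvature cov Z X Y W = 0 := by
  have expand {X Y Z : Π x : M, TangentSpace I x} (hY : IsSmoothField Y) (hZ : IsSmoothField Z) :
      nabla cov X (curvature cov Y Z W) = nabla cov X (nabla cov Y (nabla cov Z W))
        - nabla cov X (nabla cov Z (nabla cov Y W)) - nabla cov X (nabla cov (mlieBracket I Y Z) W)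
        := by
    rw [curvature, nabla_sub_right cov
      ((hY.nabla cov (hZ.nabla cov hW)).sub (hZ.nabla cov (hY.nabla cov hW)))
      ((hY.mlieBracket hZ).nabla cov hW),
      nabla_sub_right cov (hY.nabla cov (hZ.nabla cov hW)) (hZ.nabla cov (hY.nabla cov hW))]
  have tors {X Y Z : Π x : M, TangentSpace I x} (hX : IsSmoothField X) (hY : IsSmoothField Y) :
      curvature cov (nabla cov X Y) Z W - curvature cov (nabla cov Y X) Z W
        = nabla cov (mlieBracket I X Y) (nabla cov Z W)
          - nabla cov Z (nabla cov (mlieBracket I X Y) W)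
          - nabla cov (mlieBracket I (mlieBracket I X Y) Z) W := by
    rw [← curvature_sub₁ cov (hX.nabla cov hY) (hY.nabla cov hX) hW,
      nabla_sub_nabla_eq_mlieBracket cov hcov hX hY, curvature]
  have jac : nabla cov (mlieBracket I (mlieBracket I X Y) Z) W
      + nabla cov (mlieBracket I (mlieBracket I Y Z) X) W
      + nabla cov (mlieBracket I (mlieBracket I Z X) Y) W = 0 := by
    rw [← nabla_add_left, ← nabla_add_left]
    have : mlieBracket I (mlieBracket I X Y) Z + mlieBracket I (mlieBracket I Y Z) X
        + mlieBracket I (mlieBracket I Z X) Y = 0 := by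
      rw [mlieBracket_swap (V := mlieBracket I X Y), mlieBracket_swap (V := mlieBracket I Y Z),
        mlieBracket_swap (V := mlieBracket I Z X), ← neg_zero, ← mlieBracket_cyclic hX hY hZ]
      abel
    rw [this]
    funext x
    simp [nabla]
  simp only [nablaCurvature]
  rw [curvature_swap cov Y (nabla cov X Z), curvature_swap cov Z (nabla cov Y X),
    curvature_swap cov X (nabla cov Z Y), expand hY hZ, expand hZ hX, expand hX hY,
    sub_eq_iff_eq_add.1 (tors (Z := Z) hX hY), sub_eq_iff_eq_add.1 (tors (Z := X) hY hZ),
    sub_eq_iff_eq_add.1 (tors (Z := Y) hZ hX), eq_neg_of_add_eq_zero_right jac]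
  simp only [curvature]
  abel

end Curvature

section LeviCivita

variable {E : Type*} [NormedAddCommGroup E] [NormedSpace ℝ E] [FiniteDimensional ℝ E]
  {H : Type*} [TopologicalSpace H] {I : ModelWithCorners ℝ E H}
  {M : Type*} [TopologicalSpace M] [ChartedSpace H M] [IsManifold I ∞ M] [T2Space M]
  [RiemannianBundle (fun x : M ↦ TangentSpace I x)]
  [IsContMDiffRiemannianBundle I ∞ E (fun x : M ↦ TangentSpace I x)]
  {cov : CovariantDerivative I E (TangentSpace I : M → Type _)}
  [cov.ContMDiffCovariantDerivative ∞]
  {V X Y Z W : Π x : M, TangentSpace I x}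

theorem contMDiff_inner (hX : IsSmoothField X) (hY : IsSmoothField Y) :
    CMDiff ∞ (fun x ↦ inner ℝ (X x) (Y x)) :=
  ContMDiff.inner_bundle hX hY

theorem mdiffAt_inner (hX : IsSmoothField X) (hY : IsSmoothField Y) (x : M) :
    MDiffAt (fun x ↦ inner ℝ (X x) (Y x)) x :=
  (contMDiff_inner hX hY x).mdifferentiableAt (by simp)

theorem IsLeviCivita.mvfderiv_inner (hcov : IsLeviCivita cov) (hX : IsSmoothField X)
    (hY : IsSmoothField Y) (hZ : IsSmoothField Z) :
    (fun x ↦ d% (fun y ↦ inner ℝ (Y y) (Z y)) x (X x)) =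
      (fun x ↦ inner ℝ (nabla cov X Y x) (Z x)) + fun x ↦ inner ℝ (Y x) (nabla cov X Z x) :=
  funext fun x ↦ hcov.metric X Y Z hX hY hZ x

theorem IsLeviCivita.contMDiff_mvfderiv_inner (hcov : IsLeviCivita cov) (hX : IsSmoothField X)
    (hY : IsSmoothField Y) (hZ : IsSmoothField Z) :
    CMDiff ∞ (fun x ↦ d% (fun y ↦ inner ℝ (Y y) (Z y)) x (X x)) := by
  rw [hcov.mvfderiv_inner hX hY hZ]
  exact (contMDiff_inner (hX.nabla cov hY) hZ).add (contMDiff_inner hY (hX.nabla cov hZ))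

theorem IsLeviCivita.mvfderiv_mvfderiv_inner (hcov : IsLeviCivita cov)
    (hX : IsSmoothField X) (hY : IsSmoothField Y) (hZ : IsSmoothField Z) (x : M) :
    d% (fun x ↦ d% (fun y ↦ inner ℝ (Y y) (Z y)) x (X x)) x (W x) =
      d% (fun x ↦ inner ℝ (nabla cov X Y x) (Z x)) x (W x)
        + d% (fun x ↦ inner ℝ (Y x) (nabla cov X Z x)) x (W x) := by
  rw [hcov.mvfderiv_inner hX hY hZ, mvfderiv_add (mdiffAt_inner (hX.nabla cov hY) hZ x)
    (mdiffAt_inner hY (hX.nabla cov hZ) x), add_apply]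

theorem IsLeviCivita.mvfderiv_inner_mlieBracket (hcov : IsLeviCivita cov) (hW : IsSmoothField W)
    (hX : IsSmoothField X) (hY : IsSmoothField Y) (hZ : IsSmoothField Z) (x : M) :
    d% (fun y ↦ inner ℝ (Y y) (Z y)) x (mlieBracket I W X x) =
      d% (fun x ↦ d% (fun y ↦ inner ℝ (Y y) (Z y)) x (X x)) x (W x)
        - d% (fun x ↦ d% (fun y ↦ inner ℝ (Y y) (Z y)) x (W x)) x (X x) :=
  mvfderiv_mlieBracket (contMDiff_inner hY hZ) hW hX (hcov.contMDiff_mvfderiv_inner hW hY hZ)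
    (hcov.contMDiff_mvfderiv_inner hX hY hZ) x

/-- The endomorphism `R(X, Y)` is skew-adjoint. -/
theorem IsLeviCivita.inner_curvature_skew (hcov : IsLeviCivita cov) (hX : IsSmoothField X)
    (hY : IsSmoothField Y) (hZ : IsSmoothField Z) (hW : IsSmoothField W) (x : M) :
    inner ℝ (curvature cov X Y Z x) (W x) = -inner ℝ (curvature cov X Y W x) (Z x) := by
  have h := hcov.mvfderiv_inner_mlieBracket hX hY hZ hW x
  rw [hcov.mvfderiv_mvfderiv_inner hY hZ hW, hcov.mvfderiv_mvfderiv_inner hX hZ hW,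
    hcov.metric _ _ _ (hX.mlieBracket hY) hZ hW, hcov.metric _ _ _ hX (hY.nabla cov hZ) hW,
    hcov.metric _ _ _ hX hZ (hY.nabla cov hW), hcov.metric _ _ _ hY (hX.nabla cov hZ) hW,
    hcov.metric _ _ _ hY hZ (hX.nabla cov hW)] at h
  simp only [curvature, Pi.sub_apply, inner_sub_left]
  simp only [real_inner_comm (Z x)] at h ⊢
  linarith

/-- The pair symmetry of the curvature tensor. -/
theorem IsLeviCivita.inner_curvature_pair (hcov : IsLeviCivita cov) (hX : IsSmoothField X)
    (hY : IsSmoothField Y) (hZ : IsSmoothField Z) (hW : IsSmoothField W) (x : M) :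
    inner ℝ (curvature cov X Y Z x) (W x) = inner ℝ (curvature cov Z W X x) (Y x) := by
  have swap (X Y Z W : Π x : M, TangentSpace I x) :
      inner ℝ (curvature cov X Y Z x) (W x) = -inner ℝ (curvature cov Y X Z x) (W x) := by
    rw [curvature_swap, Pi.neg_apply, inner_neg_left]
  have cyc {X Y Z W : Π x : M, TangentSpace I x} (hX : IsSmoothField X) (hY : IsSmoothField Y)
      (hZ : IsSmoothField Z) : inner ℝ (curvature cov X Y Z x) (W x)
        + inner ℝ (curvature cov Y Z X x) (W x) + inner ℝ (curvature cov Z X Y x) (W x) = 0 := by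
    rw [← inner_add_left, ← inner_add_left, ← Pi.add_apply, ← Pi.add_apply,
      curvature_cyclic cov hcov.torsion_eq_zero hX hY hZ, Pi.zero_apply, inner_zero_left]
  linarith [cyc (W := W) hX hY hZ, cyc (W := X) hY hZ hW, cyc (W := Y) hZ hW hX,
    cyc (W := Z) hW hX hY, hcov.inner_curvature_skew hX hY hZ hW x,
    hcov.inner_curvature_skew hY hZ hX hW x, hcov.inner_curvature_skew hZ hX hY hW x,
    hcov.inner_curvature_skew hZ hW hX hY x, hcov.inner_curvature_skew hW hX hY hZ x,
    hcov.inner_curvature_skew hW hY hX hZ x, swap W Y X Z, swap Y W Z X, swap W Y Z X,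
    swap X Z W Y, swap X Z Y W, swap Z X W Y]

theorem lieMetric_comm (V X Y : Π x : M, TangentSpace I x) (x : M) :
    lieMetric V X Y x = lieMetric V Y X x := by
  have h : (fun y ↦ inner ℝ (X y) (Y y)) = fun y ↦ inner ℝ (Y y) (X y) :=
    funext fun y ↦ real_inner_comm _ _
  simp only [lieMetric, h, real_inner_comm (Y x), real_inner_comm _ (X x)]
  ring

theorem lieConnection_comm (hcov : cov.torsion = 0) (hV : IsSmoothField V)
    (hX : IsSmoothField X) (hY : IsSmoothField Y) :
    lieConnection cov V X Y = lieConnection cov V Y X := by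
  have t {X Y : Π x : M, TangentSpace I x} (hX : IsSmoothField X) (hY : IsSmoothField Y) :=
    nabla_sub_nabla_eq_mlieBracket cov hcov hX hY
  have hb : mlieBracket I V (nabla cov X Y) - mlieBracket I V (nabla cov Y X)
      = mlieBracket I (mlieBracket I V X) Y + mlieBracket I X (mlieBracket I V Y) := by
    rw [← mlieBracket_jacobi hV hX hY, ← t hX hY,
      mlieBracket_field_sub_right (hX.nabla cov hY) (hY.nabla cov hX)]
  rw [← t (hV.mlieBracket hX) hY, ← t hX (hV.mlieBracket hY), sub_eq_iff_eq_add] at hb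
  simp only [lieConnection, hb]
  abel

/-- The covariant derivative of the Lie derivative of the metric, `(∇_X L_V g)(Y, Z)`. -/
noncomputable def nablaLieMetric (cov : CovariantDerivative I E (TangentSpace I : M → Type _))
    (V X Y Z : Π x : M, TangentSpace I x) (x : M) : ℝ :=
  d% (lieMetric V Y Z) x (X x) - lieMetric V (nabla cov X Y) Z x - lieMetric V Y (nabla cov X Z) x

theorem nablaLieMetric_comm (cov : CovariantDerivative I E (TangentSpace I : M → Type _))
    (V X Y Z : Π x : M, TangentSpace I x) (x : M) :
    nablaLieMetric cov V X Y Z x = nablaLieMetric cov V X Z Y x := by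
  have h (X Y : Π x : M, TangentSpace I x) : lieMetric V X Y = lieMetric V Y X :=
    funext fun x ↦ lieMetric_comm V X Y x
  simp only [nablaLieMetric, h Y Z, h _ Z, h Y _]
  ring

theorem IsLeviCivita.nablaLieMetric_eq (hcov : IsLeviCivita cov) (hV : IsSmoothField V)
    (hX : IsSmoothField X) (hY : IsSmoothField Y) (hZ : IsSmoothField Z) (x : M) :
    nablaLieMetric cov V X Y Z x = inner ℝ (lieConnection cov V X Y x) (Z x)
      + inner ℝ (lieConnection cov V X Z x) (Y x) := by
  have hd : d% (lieMetric V Y Z) x (X x) =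
      d% (fun x ↦ d% (fun y ↦ inner ℝ (Y y) (Z y)) x (V x)) x (X x)
        - d% (fun y ↦ inner ℝ (mlieBracket I V Y y) (Z y)) x (X x)
        - d% (fun y ↦ inner ℝ (Y y) (mlieBracket I V Z y)) x (X x) := by
    have h₀ : MDiffAt (fun x ↦ d% (fun y ↦ inner ℝ (Y y) (Z y)) x (V x)) x :=
      (hcov.contMDiff_mvfderiv_inner hV hY hZ x).mdifferentiableAt (by simp)
    have h₁ := mdiffAt_inner (hV.mlieBracket hY) hZ x
    have h₂ := mdiffAt_inner hY (hV.mlieBracket hZ) x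
    have : lieMetric V Y Z = ((fun x ↦ d% (fun y ↦ inner ℝ (Y y) (Z y)) x (V x))
      - fun y ↦ inner ℝ (mlieBracket I V Y y) (Z y))
      - fun y ↦ inner ℝ (Y y) (mlieBracket I V Z y) := rfl
    rw [this, mvfderiv_sub (h₀.sub h₁) h₂, mvfderiv_sub h₀ h₁]
    rfl
  have h := hcov.mvfderiv_inner_mlieBracket hV hX hY hZ x
  rw [hcov.mvfderiv_mvfderiv_inner hX hY hZ, hcov.metric _ _ _ (hV.mlieBracket hX) hY hZ] at h
  rw [nablaLieMetric, hd, hcov.metric _ _ _ hX (hV.mlieBracket hY) hZ,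
    hcov.metric _ _ _ hX hY (hV.mlieBracket hZ)]
  simp only [lieMetric, lieConnection, Pi.sub_apply, inner_sub_left]
  simp only [real_inner_comm (Y x)] at h ⊢
  linarith

/-- The Yano formula for the Lie derivative of the Levi-Civita connection. -/
theorem IsLeviCivita.two_mul_inner_lieConnection (hcov : IsLeviCivita cov) (hV : IsSmoothField V)
    (hX : IsSmoothField X) (hY : IsSmoothField Y) (hZ : IsSmoothField Z) (x : M) :
    2 * inner ℝ (lieConnection cov V X Y x) (Z x) = nablaLieMetric cov V X Y Z x
      + nablaLieMetric cov V Y X Z x - nablaLieMetric cov V Z X Y x := by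
  have ht := hcov.torsion_eq_zero
  rw [hcov.nablaLieMetric_eq hV hX hY hZ, hcov.nablaLieMetric_eq hV hY hX hZ,
    hcov.nablaLieMetric_eq hV hZ hX hY, lieConnection_comm ht hV hY hX,
    lieConnection_comm ht hV hZ hX, lieConnection_comm ht hV hZ hY]
  ring

end LeviCivita

section Trace

variable {E : Type*} [NormedAddCommGroup E] [NormedSpace ℝ E] [FiniteDimensional ℝ E]
  {H : Type*} [TopologicalSpace H] {I : ModelWithCorners ℝ E H}
  {M : Type*} [TopologicalSpace M] [ChartedSpace H M] [IsManifold I ∞ M] [T2Space M]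

theorem mvfderiv_finset_sum {ι : Type} {x : M} {f : ι → M → ℝ} (s : Finset ι)
    (hf : ∀ i ∈ s, MDiffAt (f i) x) :
    d% (∑ i ∈ s, f i) x = ∑ i ∈ s, d% (f i) x := by
  classical
  induction s using Finset.induction_on with
  | empty => simp
  | insert i s hi ih =>
    have hs : ∀ j ∈ s, MDiffAt (f j) x := fun j hj ↦ hf j (Finset.mem_insert_of_mem hj)
    rw [Finset.sum_insert hi, Finset.sum_insert hi,
      mvfderiv_add (hf i (Finset.mem_insert_self i s)) (MDifferentiableAt.sum hs), ih hs]

theorem cov_finset_sum (cov : CovariantDerivative I E (TangentSpace I : M → Type _))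
    {ι : Type*} {x : M} {σ : ι → Π x : M, TangentSpace I x} (s : Finset ι)
    (hσ : ∀ i ∈ s, MDiffAt (T% (σ i)) x) :
    cov (fun y ↦ ∑ i ∈ s, σ i y) x = ∑ i ∈ s, cov (σ i) x := by
  classical
  induction s using Finset.induction_on with
  | empty =>
    simp only [Finset.sum_empty]
    exact congrFun cov.zero x
  | insert i s hi ih =>
    have hs : ∀ j ∈ s, MDiffAt (T% (σ j)) x := fun j hj ↦ hσ j (Finset.mem_insert_of_mem hj)
    simp only [Finset.sum_insert hi]
    rw [← ih hs]
    exact cov.isCovariantDerivativeOnUniv.add (hσ i (Finset.mem_insert_self i s))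
      (MDifferentiableAt.sum_section hs)

theorem extendField_eventuallyEq_localFrame {ι : Type*} (b : Module.Basis ι ℝ E) (x : M) (i : ι) :
    letI t := trivializationAt E (TangentSpace I : M → Type _) x
    ∀ᶠ y in nhds x, extendField (t.localFrame b i x) y = t.localFrame b i y := by
  set t := trivializationAt E (TangentSpace I : M → Type _) x
  have hx : x ∈ t.baseSet := FiberBundle.mem_baseSet_trivializationAt' x
  filter_upwards [(Classical.arbitrary (SmoothBumpFunction I x)).eventuallyEq_one,
    t.open_baseSet.mem_nhds hx] with y hy hyt
  change (Classical.arbitrary (SmoothBumpFunction I x)) y •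
    t.symm y (t ⟨x, t.localFrame b i x⟩).2 = _
  have h : (t ⟨x, t.localFrame b i x⟩).2 = b i := by
    simp [hx, Trivialization.basisAt]
  rw [hy, h, Pi.one_apply, one_smul, t.localFrame_apply_of_mem_baseSet b hyt]
  simp [Trivialization.basisAt]

/-- The derivative of the trace of an endomorphism field is the trace of its covariant
derivative. -/
theorem mvfderiv_trace (cov : CovariantDerivative I E (TangentSpace I : M → Type _))
    [cov.ContMDiffCovariantDerivative ∞] {U : Π x : M, TangentSpace I x}
    (A : Π y : M, TangentSpace I y →ₗ[ℝ] TangentSpace I y)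
    (hA : ∀ X : Π x : M, TangentSpace I x, IsSmoothField X → IsSmoothField (fun y ↦ A y (X y)))
    (x : M) (B : TangentSpace I x →ₗ[ℝ] TangentSpace I x)
    (hB : ∀ X : Π x : M, TangentSpace I x, IsSmoothField X →
      B (X x) = nabla cov U (fun y ↦ A y (X y)) x - A x (nabla cov U X x)) :
    MDiffAt (fun y ↦ LinearMap.trace ℝ _ (A y)) x ∧
      d% (fun y ↦ LinearMap.trace ℝ _ (A y)) x (U x) = LinearMap.trace ℝ _ B := by
  classical
  set t := trivializationAt E (TangentSpace I : M → Type _) x with ht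
  have hx : x ∈ t.baseSet := FiberBundle.mem_baseSet_trivializationAt' x
  set b := Module.finBasis ℝ E
  let e := t.basisAt b hx
  let S (i) : Π y : M, TangentSpace I y := extendField (t.localFrame b i x)
  have hS (i) : IsSmoothField (S i) := isSmoothField_extendField _
  have hSx (i) : S i x = e i := by
    rw [← t.localFrame_apply_of_mem_baseSet b hx]
    exact extendField_self _
  have hSev : ∀ᶠ y in nhds x, ∀ i, S i y = t.localFrame b i y :=
    Filter.eventually_all.2 fun i ↦ extendField_eventuallyEq_localFrame b x i
  let a (i j) (y : M) : ℝ := t.localFrameCoeff I b j y (A y (S i y))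
  have ha (i j) : MDiffAt (a i j) x :=
    mdifferentiableAt_localFrameCoeff b hx ((hA _ (hS i)).mdiffAt x) j
  have hax (i j) : a i j x = e.repr (A x (e i)) j := by
    rw [← hSx i]
    exact t.localFrameCoeff_apply_of_mem_baseSet b hx (fun y ↦ A y (S i y)) j
  have hAS (i) : ∀ᶠ y in nhds x, A y (S i y) = ∑ j, (a i j • S j) y := by
    filter_upwards [hSev, t.open_baseSet.mem_nhds hx] with y hy hyt
    rw [Finset.sum_congr rfl fun j _ ↦ by rw [Pi.smul_apply', hy j]]
    exact t.eq_sum_localFrameCoeff_smul (s := fun y ↦ A y (S i y)) hyt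
  have htr : (fun y ↦ LinearMap.trace ℝ _ (A y)) =ᶠ[nhds x] ∑ i, a i i := by
    filter_upwards [hSev, t.open_baseSet.mem_nhds hx] with y hy hyt
    rw [LinearMap.trace_eq_matrix_trace ℝ (t.basisAt b hyt), Matrix.trace, Finset.sum_apply]
    refine Finset.sum_congr rfl fun i _ ↦ ?_
    rw [Matrix.diag_apply, LinearMap.toMatrix_apply, ← t.localFrame_apply_of_mem_baseSet b hyt,
      ← hy i]
    exact (t.localFrameCoeff_apply_of_mem_baseSet b hyt (fun y ↦ A y (S i y)) i).symm
  have hsum : MDiffAt (∑ i, a i i) x := MDifferentiableAt.sum fun i _ ↦ ha i i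
  refine ⟨hsum.congr_of_eventuallyEq htr, ?_⟩
  let Wm : TangentSpace I x →ₗ[ℝ] TangentSpace I x := e.constr ℝ fun i ↦ nabla cov U (S i) x
  let Dm : TangentSpace I x →ₗ[ℝ] TangentSpace I x :=
    e.constr ℝ fun i ↦ ∑ j, d% (a i j) x (U x) • e j
  have hdec : B = Dm + (Wm * A x - A x * Wm) := by
    refine e.ext fun i ↦ ?_
    have hsm (j) : MDiffAt (T% (a i j • S j)) x :=
      MDifferentiableAt.smul_section (ha i j) ((hS j).mdiffAt x)
    have hcov : nabla cov U (fun y ↦ A y (S i y)) x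
        = ∑ j, (a i j x • nabla cov U (S j) x + d% (a i j) x (U x) • S j x) := by
      rw [nabla, cov.isCovariantDerivativeOnUniv.congr_of_eventuallyEq ((hA _ (hS i)).mdiffAt x)
        (MDifferentiableAt.sum_section fun j _ ↦ hsm j) Filter.univ_mem (hAS i),
        cov_finset_sum cov _ fun j _ ↦ hsm j, sum_apply]
      refine Finset.sum_congr rfl fun j _ ↦ ?_
      rw [cov.isCovariantDerivativeOnUniv.leibniz ((hS j).mdiffAt x) (ha i j)]
      simp [nabla]
    have hW : Wm (A x (e i)) = ∑ j, a i j x • nabla cov U (S j) x := by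
      conv_lhs => rw [← e.sum_repr (A x (e i))]
      simp [Wm, hax]
    have h := hB (S i) (hS i)
    rw [hcov, hSx, Finset.sum_add_distrib, ← hW] at h
    rw [h]
    simp only [LinearMap.add_apply, LinearMap.sub_apply, Module.End.mul_apply, Dm, Wm,
      Module.Basis.constr_basis, hSx]
    abel
  have hDm : LinearMap.trace ℝ _ Dm = ∑ i, d% (a i i) x (U x) := by
    rw [LinearMap.trace_eq_matrix_trace ℝ e, Matrix.trace]
    refine Finset.sum_congr rfl fun i _ ↦ ?_
    simp [LinearMap.toMatrix_apply, Dm, Finsupp.single_apply]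
  have hd : d% (fun y ↦ LinearMap.trace ℝ _ (A y)) x = d% (∑ i, a i i) x := by
    simp only [mvfderiv, htr.mfderiv_eq]
    rfl
  rw [hd, mvfderiv_finset_sum _ fun i _ ↦ ha i i, hdec, map_add, map_sub,
    LinearMap.trace_mul_comm, sub_self, add_zero, hDm, sum_apply]

end Trace

section Structure

variable {E : Type*} [NormedAddCommGroup E] [NormedSpace ℝ E] [FiniteDimensional ℝ E]
  {H : Type*} [TopologicalSpace H] {I : ModelWithCorners ℝ E H}
  {M : Type*} [TopologicalSpace M] [ChartedSpace H M] [IsManifold I ∞ M] [T2Space M]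
  [RiemannianBundle (fun x : M ↦ TangentSpace I x)]
  [IsContMDiffRiemannianBundle I ∞ E (fun x : M ↦ TangentSpace I x)]
  {cov : CovariantDerivative I E (TangentSpace I : M → Type _)}
  [cov.ContMDiffCovariantDerivative ∞]
  {φ : Π x : M, TangentSpace I x →L[ℝ] TangentSpace I x}
  {ξ : Π x : M, TangentSpace I x} {η : Π x : M, TangentSpace I x →L[ℝ] ℝ}
  {X Y Z W : Π x : M, TangentSpace I x}

namespace IsAlmostContactMetric

theorem inner_ξ_self (h : IsAlmostContactMetric φ ξ η) (x : M) :
    inner ℝ (ξ x) (ξ x) = (1 : ℝ) := by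
  rw [← h.η_eq, h.η_ξ]

theorem φ_ξ (h : IsAlmostContactMetric φ ξ η) (x : M) : φ x (ξ x) = 0 := by
  rw [← inner_self_eq_zero (𝕜 := ℝ), h.inner_φ, h.inner_ξ_self, h.η_ξ]
  norm_num

theorem η_φ (h : IsAlmostContactMetric φ ξ η) (x : M) (v : TangentSpace I x) :
    η x (φ x v) = 0 := by
  have h₁ := h.φ_sq x (φ x v)
  rw [h.φ_sq x v, map_add, map_neg, map_smul, h.φ_ξ, smul_zero] at h₁
  have h₂ : η x (φ x v) • ξ x = 0 := by simpa using h₁.symm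
  have h₃ := congrArg (η x) h₂
  simpa [h.η_ξ] using h₃

end IsAlmostContactMetric

theorem IsKenmotsu.nabla_ξ (hcov : IsLeviCivita cov) (hK : IsKenmotsu cov φ ξ η)
    (hX : IsSmoothField X) : nabla cov X ξ = X - (fun y ↦ inner ℝ (X y) (ξ y)) • ξ := by
  have hξ := hK.smooth_ξ
  funext x
  have h := hK.nabla_φ X ξ hX hξ x
  have h0 : (fun y ↦ φ y (ξ y)) = 0 := funext fun y ↦ hK.φ_ξ y
  rw [h0, ← hK.η_eq, hK.η_φ, hK.η_ξ, nabla, cov.zero] at h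
  have h1 : φ x (nabla cov X ξ x) = φ x (X x) := by simpa using h
  have h2 : η x (nabla cov X ξ x) = 0 := by
    have hm := hcov.metric X ξ ξ hX hξ hξ x
    have hc : (fun y ↦ inner ℝ (ξ y) (ξ y)) = fun _ : M ↦ (1 : ℝ) :=
      funext fun y ↦ hK.inner_ξ_self y
    rw [hc, mvfderiv_const, real_inner_comm _ (ξ x)] at hm
    rw [hK.η_eq]
    simp only [zero_apply] at hm
    linarith
  have h3 := congrArg (φ x) h1
  rw [hK.φ_sq, hK.φ_sq, h2, zero_smul, add_zero] at h3
  rw [Pi.sub_apply, Pi.smul_apply', ← hK.η_eq, ← neg_inj, h3]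
  abel

theorem IsKenmotsu.mvfderiv_inner_ξ (hcov : IsLeviCivita cov) (hK : IsKenmotsu cov φ ξ η)
    (hX : IsSmoothField X) (hY : IsSmoothField Y) (x : M) :
    d% (fun y ↦ inner ℝ (Y y) (ξ y)) x (X x) = inner ℝ (nabla cov X Y x) (ξ x)
      + inner ℝ (X x) (Y x) - inner ℝ (X x) (ξ x) * inner ℝ (Y x) (ξ x) := by
  rw [hcov.metric X Y ξ hX hY hK.smooth_ξ, hK.nabla_ξ hcov hX, Pi.sub_apply, Pi.smul_apply',
    inner_sub_right, inner_smul_right, real_inner_comm (X x) (Y x)]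
  ring

/-- `R(X, Y)ξ = η(X)Y - η(Y)X`. -/
theorem IsKenmotsu.curvature_ξ (hcov : IsLeviCivita cov) (hK : IsKenmotsu cov φ ξ η)
    (hX : IsSmoothField X) (hY : IsSmoothField Y) (x : M) :
    curvature cov X Y ξ x
      = (inner ℝ (X x) (ξ x) : ℝ) • Y x - (inner ℝ (Y x) (ξ x) : ℝ) • X x := by
  have hξ := hK.smooth_ξ
  have e {X Y : Π x : M, TangentSpace I x} (hX : IsSmoothField X) (hY : IsSmoothField Y) :
      nabla cov X (nabla cov Y ξ) x = nabla cov X Y x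
        - (inner ℝ (nabla cov X Y x) (ξ x) + inner ℝ (X x) (Y x)
          - inner ℝ (X x) (ξ x) * inner ℝ (Y x) (ξ x) : ℝ) • ξ x
        - (inner ℝ (Y x) (ξ x) : ℝ) • (X x - (inner ℝ (X x) (ξ x) : ℝ) • ξ x) := by
    rw [hK.nabla_ξ hcov hY, nabla_sub_right cov hY (.smul (contMDiff_inner hY hξ) hξ),
      nabla_fun_smul_right cov (contMDiff_inner hY hξ) hξ, hK.nabla_ξ hcov hX]
    simp only [Pi.sub_apply, Pi.add_apply, Pi.smul_apply', hK.mvfderiv_inner_ξ hcov hX hY x]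
    module
  rw [curvature, Pi.sub_apply, Pi.sub_apply, e hX hY, e hY hX,
    hK.nabla_ξ hcov (hX.mlieBracket hY),
    ← nabla_sub_nabla_eq_mlieBracket cov hcov.torsion_eq_zero hX hY, real_inner_comm (X x) (Y x)]
  simp only [Pi.sub_apply, Pi.smul_apply', inner_sub_left]
  module

/-- `R(X, ξ)Z = g(X, Z)ξ - η(Z)X`. -/
theorem IsKenmotsu.curvature_ξ_right (hcov : IsLeviCivita cov) (hK : IsKenmotsu cov φ ξ η)
    (hX : IsSmoothField X) (hZ : IsSmoothField Z) :
    curvature cov X ξ Z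
      = (fun y ↦ inner ℝ (X y) (Z y)) • ξ - (fun y ↦ inner ℝ (Z y) (ξ y)) • X := by
  have hξ := hK.smooth_ξ
  funext x
  refine ext_inner_right ℝ fun w ↦ ?_
  have hw : IsSmoothField (extendField w) := isSmoothField_extendField w
  have h := hcov.inner_curvature_pair hX hξ hZ hw x
  rw [hcov.inner_curvature_skew hZ hw hX hξ, hK.curvature_ξ hcov hZ hw, extendField_self] at h
  rw [h]
  simp only [Pi.sub_apply, Pi.smul_apply', inner_sub_left, real_inner_smul_left]
  rw [real_inner_comm (X x) w, real_inner_comm (X x) (Z x), real_inner_comm w (ξ x)]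
  ring

theorem curvature_fun_smul₂ (cov : CovariantDerivative I E (TangentSpace I : M → Type _))
    [cov.ContMDiffCovariantDerivative ∞] {f : M → ℝ} (hf : CMDiff ∞ f)
    (hY : IsSmoothField Y) (hZ : IsSmoothField Z) :
    curvature cov X (f • Y) Z = f • curvature cov X Y Z := by
  funext x
  have h := (tensorialAt_curvature₁ cov (Y := X) hZ x).smul ((hf x).mdifferentiableAt (by simp))
    (hY.mdiffAt x)
  rw [curvature_swap cov X (f • Y), curvature_swap cov X Y, smul_neg, Pi.neg_apply, h]
  rfl

theorem curvature_sub₂ (cov : CovariantDerivative I E (TangentSpace I : M → Type _))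
    [cov.ContMDiffCovariantDerivative ∞]
    (hY : IsSmoothField Y) (hZ : IsSmoothField Z) (hW : IsSmoothField W) :
    curvature cov X (Y - Z) W = curvature cov X Y W - curvature cov X Z W := by
  rw [curvature_swap cov X (Y - Z), curvature_sub₁ cov hY hZ hW, curvature_swap cov X Y,
    curvature_swap cov X Z]
  abel

theorem nablaCurvature_swap (cov : CovariantDerivative I E (TangentSpace I : M → Type _))
    [cov.ContMDiffCovariantDerivative ∞]
    (hX : IsSmoothField X) (hY : IsSmoothField Y) (hZ : IsSmoothField Z) :
    nablaCurvature cov W X Y Z = -nablaCurvature cov W Y X Z := by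
  simp only [nablaCurvature]
  rw [curvature_swap cov X Y, curvature_swap cov X (nabla cov W Y),
    curvature_swap cov (nabla cov W X) Y, nabla_neg_right cov (hY.curvature cov hX hZ),
    curvature_swap cov X Y]
  abel

theorem IsKenmotsu.nablaCurvature_ξ_right (hcov : IsLeviCivita cov) (hK : IsKenmotsu cov φ ξ η)
    (hX : IsSmoothField X) (hY : IsSmoothField Y) (hZ : IsSmoothField Z) (x : M) :
    nablaCurvature cov X Y ξ Z x =
      (inner ℝ (Y x) (Z x) : ℝ) • X x - (inner ℝ (X x) (Z x) : ℝ) • Y x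
        - curvature cov Y X Z x := by
  have hξ := hK.smooth_ξ
  have hm := hcov.metric X Y Z hX hY hZ x
  rw [nablaCurvature, hK.curvature_ξ_right hcov hY hZ,
    hK.curvature_ξ_right hcov (hX.nabla cov hY) hZ, hK.curvature_ξ_right hcov hY (hX.nabla cov hZ),
    nabla_sub_right cov (.smul (contMDiff_inner hY hZ) hξ) (.smul (contMDiff_inner hZ hξ) hY),
    nabla_fun_smul_right cov (contMDiff_inner hY hZ) hξ,
    nabla_fun_smul_right cov (contMDiff_inner hZ hξ) hY, hK.nabla_ξ hcov hX,
    curvature_sub₂ cov hX (.smul (contMDiff_inner hX hξ) hξ) hZ,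
    curvature_fun_smul₂ cov (contMDiff_inner hX hξ) hξ hZ, hK.curvature_ξ_right hcov hY hZ]
  simp only [Pi.sub_apply, Pi.add_apply, Pi.smul_apply', hm, hK.mvfderiv_inner_ξ hcov hX hZ x]
  module

/-- `(∇_ξ R)(X, Y)Z = -2R(X, Y)Z - 2(g(Y, Z)X - g(X, Z)Y)`. -/
theorem IsKenmotsu.nablaCurvature_ξ (hcov : IsLeviCivita cov) (hK : IsKenmotsu cov φ ξ η)
    (hX : IsSmoothField X) (hY : IsSmoothField Y) (hZ : IsSmoothField Z) (x : M) :
    nablaCurvature cov ξ X Y Z x = (-2 : ℝ) • curvature cov X Y Z x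
      - (2 : ℝ) • ((inner ℝ (Y x) (Z x) : ℝ) • X x - (inner ℝ (X x) (Z x) : ℝ) • Y x) := by
  have hξ := hK.smooth_ξ
  have h := congrFun (nablaCurvature_cyclic cov hcov.torsion_eq_zero hξ hX hY hZ) x
  rw [nablaCurvature_swap cov (W := Y) hξ hX hZ] at h
  simp only [Pi.add_apply, Pi.neg_apply, Pi.zero_apply, hK.nablaCurvature_ξ_right hcov hX hY hZ,
    hK.nablaCurvature_ξ_right hcov hY hX hZ, curvature_swap cov Y X] at h
  rw [← sub_eq_zero, ← h]
  module

theorem finrank_tangentSpace (x : M) :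
    Module.finrank ℝ (TangentSpace I x) = Module.finrank ℝ E := rfl

/-- `S(v, ξ) = -(d - 1)η(v)` in dimension `d`. -/
theorem IsKenmotsu.ricci_ξ (hcov : IsLeviCivita cov) (hK : IsKenmotsu cov φ ξ η) (x : M)
    (v : TangentSpace I x) :
    ricci cov x v (ξ x) = -((Module.finrank ℝ E : ℝ) - 1) * inner ℝ v (ξ x) := by
  have : FiniteDimensional ℝ (TangentSpace I x) := inferInstanceAs (FiniteDimensional ℝ E)
  have h : curvatureEnd cov x v (ξ x) = (η x : TangentSpace I x →ₗ[ℝ] ℝ).smulRight v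
      - (inner ℝ v (ξ x) : ℝ) • LinearMap.id := by
    ext u
    have hu := curvatureEnd_apply cov hcov.torsion_eq_zero (isSmoothField_extendField u)
      (isSmoothField_extendField v) hK.smooth_ξ x
    rw [hK.curvature_ξ hcov (isSmoothField_extendField u) (isSmoothField_extendField v),
      extendField_self, extendField_self] at hu
    simp [hu, hK.η_eq]
  change LinearMap.trace ℝ _ (curvatureEnd cov x v (ξ x)) = _
  rw [h, map_sub, map_smul, LinearMap.trace_smulRight, LinearMap.trace_id, finrank_tangentSpace]
  simp only [ContinuousLinearMap.coe_coe, hK.η_eq, smul_eq_mul]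
  ring

/-- `(∇_ξ S)(Y, Z) = -2S(Y, Z) - 2(d - 1)g(Y, Z)` in dimension `d`. -/
theorem IsKenmotsu.mvfderiv_ricci_ξ (hcov : IsLeviCivita cov) (hK : IsKenmotsu cov φ ξ η)
    (hY : IsSmoothField Y) (hZ : IsSmoothField Z) (x : M) :
    MDiffAt (fun y ↦ ricci cov y (Y y) (Z y)) x ∧
    d% (fun y ↦ ricci cov y (Y y) (Z y)) x (ξ x) =
      ricci cov x (nabla cov ξ Y x) (Z x) + ricci cov x (Y x) (nabla cov ξ Z x)
        - 2 * ricci cov x (Y x) (Z x)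
        - 2 * ((Module.finrank ℝ E : ℝ) - 1) * inner ℝ (Y x) (Z x) := by
  have : FiniteDimensional ℝ (TangentSpace I x) := inferInstanceAs (FiniteDimensional ℝ E)
  have hξ := hK.smooth_ξ
  have ht := hcov.torsion_eq_zero
  have happ (X) (hX : IsSmoothField X) :
      (fun y ↦ curvatureEnd cov y (Y y) (Z y) (X y)) = curvature cov X Y Z :=
    funext fun y ↦ curvatureEnd_apply cov ht hX hY hZ y
  let gZ : TangentSpace I x →ₗ[ℝ] ℝ := (innerSL ℝ (Z x) : TangentSpace I x →L[ℝ] ℝ)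
  have hg (v : TangentSpace I x) : gZ v = inner ℝ v (Z x) := by
    rw [real_inner_comm]
    rfl
  have h := mvfderiv_trace cov (U := ξ) (fun y ↦ curvatureEnd cov y (Y y) (Z y))
    (fun X hX ↦ by rw [happ X hX]; exact hX.curvature cov hY hZ) x
    (curvatureEnd cov x (nabla cov ξ Y x) (Z x) + curvatureEnd cov x (Y x) (nabla cov ξ Z x)
      - (2 : ℝ) • curvatureEnd cov x (Y x) (Z x)
      - (2 : ℝ) • ((inner ℝ (Y x) (Z x) : ℝ) • LinearMap.id - gZ.smulRight (Y x)))
    (fun X hX ↦ by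
      have hR := hK.nablaCurvature_ξ hcov hX hY hZ x
      simp only [nablaCurvature, Pi.sub_apply] at hR
      rw [happ X hX, curvatureEnd_apply cov ht (hξ.nabla cov hX) hY hZ]
      simp only [LinearMap.add_apply, LinearMap.sub_apply, LinearMap.smul_apply, LinearMap.id_apply,
        LinearMap.smulRight_apply, curvatureEnd_apply cov ht hX hY hZ,
        curvatureEnd_apply cov ht hX (hξ.nabla cov hY) hZ,
        curvatureEnd_apply cov ht hX hY (hξ.nabla cov hZ)]
      rw [hg, ← sub_eq_zero, ← sub_eq_zero.2 hR.symm]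
      module)
  refine ⟨h.1, ?_⟩
  change d% (fun y ↦ LinearMap.trace ℝ _ (curvatureEnd cov y (Y y) (Z y))) x (ξ x) = _
  rw [h.2]
  simp only [map_add, map_sub, map_smul, LinearMap.trace_smulRight, LinearMap.trace_id,
    finrank_tangentSpace, hg, smul_eq_mul]
  change ricci cov x _ _ + ricci cov x _ _ - 2 * ricci cov x _ _ - _ = _
  ring

end Structure

section Soliton

variable {E : Type*} [NormedAddCommGroup E] [NormedSpace ℝ E] [FiniteDimensional ℝ E]
  {H : Type*} [TopologicalSpace H] {I : ModelWithCorners ℝ E H}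
  {M : Type*} [TopologicalSpace M] [ChartedSpace H M] [IsManifold I ∞ M] [T2Space M]

theorem mvfderiv_const_mul {f : M → ℝ} {x : M} (c : ℝ) (hf : MDiffAt f x) :
    d% (fun y ↦ c * f y) x = c • d% f x := by
  have h := mvfderiv_mul (f := fun _ : M ↦ c) mdifferentiableAt_const hf
  rw [mvfderiv_const, smul_zero, add_zero] at h
  exact h

theorem mdiffAt_const_mul {f : M → ℝ} {x : M} (c : ℝ) (hf : MDiffAt f x) :
    MDiffAt (fun y ↦ c * f y) x :=
  MDifferentiableAt.mul (p := fun _ : M ↦ c) mdifferentiableAt_const hf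

variable [RiemannianBundle (fun x : M ↦ TangentSpace I x)]
  [IsContMDiffRiemannianBundle I ∞ E (fun x : M ↦ TangentSpace I x)]
  {cov : CovariantDerivative I E (TangentSpace I : M → Type _)}
  [cov.ContMDiffCovariantDerivative ∞]
  {φ : Π x : M, TangentSpace I x →L[ℝ] TangentSpace I x}
  {ξ : Π x : M, TangentSpace I x} {η : Π x : M, TangentSpace I x →L[ℝ] ℝ}
  {V X Y Z : Π x : M, TangentSpace I x} {lam mu p : ℝ}

namespace IsConformalEtaRicciSoliton

theorem lieMetric_eq (hK : IsKenmotsu cov φ ξ η)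
    (hsol : IsConformalEtaRicciSoliton cov η V lam mu p)
    (hX : IsSmoothField X) (hY : IsSmoothField Y) (x : M) :
    lieMetric V X Y x = -2 * ricci cov x (X x) (Y x)
      - (2 * lam - (p + 2 / (Module.finrank ℝ E : ℝ))) * inner ℝ (X x) (Y x)
      - 2 * mu * (inner ℝ (X x) (ξ x) * inner ℝ (Y x) (ξ x)) := by
  have h := hsol.eq_zero X Y hX hY x
  rw [hK.η_eq, hK.η_eq] at h
  linarith

/-- On a Kenmotsu manifold `(L_V g)(X, ξ)` is a constant multiple of `η(X)`. -/
theorem lieMetric_ξ (hcov : IsLeviCivita cov) (hK : IsKenmotsu cov φ ξ η)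
    (hsol : IsConformalEtaRicciSoliton cov η V lam mu p) (hX : IsSmoothField X) :
    lieMetric V X ξ = fun x ↦ (2 * ((Module.finrank ℝ E : ℝ) - 1)
      - (2 * lam - (p + 2 / (Module.finrank ℝ E : ℝ))) - 2 * mu) * inner ℝ (X x) (ξ x) := by
  funext x
  rw [lieMetric_eq hK hsol hX hK.smooth_ξ, hK.ricci_ξ hcov, hK.inner_ξ_self]
  ring

theorem nablaLieMetric_ξ (hcov : IsLeviCivita cov) (hK : IsKenmotsu cov φ ξ η)
    (hsol : IsConformalEtaRicciSoliton cov η V lam mu p) (hX : IsSmoothField X)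
    (hY : IsSmoothField Y) (x : M) :
    nablaLieMetric cov V X Y ξ x = (2 * ((Module.finrank ℝ E : ℝ) - 1)
      - (2 * lam - (p + 2 / (Module.finrank ℝ E : ℝ))) - 2 * mu) * inner ℝ (X x) (Y x)
      - lieMetric V Y X x := by
  have hξ := hK.smooth_ξ
  have hd := hK.mvfderiv_inner_ξ hcov hX hY x
  rw [nablaLieMetric, lieMetric_ξ hcov hK hsol hY, lieMetric_ξ hcov hK hsol (hX.nabla cov hY),
    mvfderiv_const_mul _ (mdiffAt_inner hY hξ x), smul_apply, hd,
    lieMetric_eq hK hsol hY (hX.nabla cov hξ), lieMetric_eq hK hsol hY hX, hK.nabla_ξ hcov hX]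
  simp only [Pi.sub_apply, Pi.smul_apply', map_sub, map_smul, inner_sub_left, inner_sub_right,
    real_inner_smul_left, real_inner_smul_right, hK.inner_ξ_self, smul_eq_mul, hK.ricci_ξ hcov]
  ring

theorem nablaLieMetric_along_ξ (hcov : IsLeviCivita cov) (hK : IsKenmotsu cov φ ξ η)
    (hsol : IsConformalEtaRicciSoliton cov η V lam mu p) (hY : IsSmoothField Y)
    (hZ : IsSmoothField Z) (x : M) :
    nablaLieMetric cov V ξ Y Z x = 4 * ricci cov x (Y x) (Z x)
      + 4 * ((Module.finrank ℝ E : ℝ) - 1) * inner ℝ (Y x) (Z x) := by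
  have hξ := hK.smooth_ξ
  obtain ⟨hS, hdS⟩ := hK.mvfderiv_ricci_ξ hcov hY hZ x
  have hg := mdiffAt_inner hY hZ x
  have hYξ := mdiffAt_inner hY hξ x
  have hZξ := mdiffAt_inner hZ hξ x
  have hL : lieMetric V Y Z = (fun y ↦ -2 * ricci cov y (Y y) (Z y))
      - (fun y ↦ (2 * lam - (p + 2 / (Module.finrank ℝ E : ℝ))) * inner ℝ (Y y) (Z y))
      - fun y ↦ 2 * mu * ((fun y ↦ inner ℝ (Y y) (ξ y)) * fun y ↦ inner ℝ (Z y) (ξ y)) y :=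
    funext fun y ↦ lieMetric_eq hK hsol hY hZ y
  have hηη : MDiffAt ((fun y ↦ inner ℝ (Y y) (ξ y)) * fun y ↦ inner ℝ (Z y) (ξ y)) x :=
    hYξ.mul hZξ
  rw [nablaLieMetric, lieMetric_eq hK hsol (hξ.nabla cov hY) hZ,
    lieMetric_eq hK hsol hY (hξ.nabla cov hZ), hL,
    mvfderiv_sub ((mdiffAt_const_mul _ hS).sub (mdiffAt_const_mul _ hg)) (mdiffAt_const_mul _ hηη),
    mvfderiv_sub (mdiffAt_const_mul _ hS) (mdiffAt_const_mul _ hg), mvfderiv_const_mul _ hS,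
    mvfderiv_const_mul _ hg, mvfderiv_const_mul _ hηη, mvfderiv_mul hYξ hZξ]
  simp only [sub_apply, add_apply, smul_apply, smul_eq_mul,
    hdS, hcov.metric ξ Y Z hξ hY hZ x, hK.mvfderiv_inner_ξ hcov hξ hY x,
    hK.mvfderiv_inner_ξ hcov hξ hZ x, hK.inner_ξ_self, real_inner_comm _ (ξ x)]
  ring

/-- `(L_V ∇)(X, ξ) = 2QX + 2(d - 1)X` in dimension `d`. -/
theorem lieConnection_ξ (hcov : IsLeviCivita cov) (hK : IsKenmotsu cov φ ξ η)
    (hsol : IsConformalEtaRicciSoliton cov η V lam mu p) (hX : IsSmoothField X) (x : M) :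
    lieConnection cov V X ξ x = (2 : ℝ) • ricciOperator cov x (X x)
      + (2 * ((Module.finrank ℝ E : ℝ) - 1)) • X x := by
  have hξ := hK.smooth_ξ
  refine ext_inner_right ℝ fun w ↦ ?_
  have hw : IsSmoothField (extendField w) := isSmoothField_extendField w
  have h := hcov.two_mul_inner_lieConnection hsol.smooth_V hX hξ hw x
  rw [nablaLieMetric_comm cov V X ξ, nablaLieMetric_ξ hcov hK hsol hX hw,
    nablaLieMetric_ξ hcov hK hsol hw hX, nablaLieMetric_along_ξ hcov hK hsol hX hw,
    lieMetric_comm V X, real_inner_comm (X x) (extendField w x), extendField_self] at h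
  rw [inner_add_left, real_inner_smul_left, real_inner_smul_left, inner_ricciOperator]
  linarith

end IsConformalEtaRicciSoliton

end Soliton
end Kenmotsu

/-- On a `(2n+1)`-dimensional Kenmotsu manifold with a conformal `η`-Ricci soliton `(g, V, λ, μ)`,
`(L_V ∇)(X, ξ) = 2QX + 4nX` for every smooth vector field `X`. -/
theorem lie_derivative_connection_eq_of_conformal_eta_ricci_soliton
    {n : ℕ} {M : Type*} [TopologicalSpace M] [T2Space M]
    [ChartedSpace (EuclideanSpace ℝ (Fin (2 * n + 1))) M] [IsManifold (𝓡 (2 * n + 1)) ∞ M]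
    [RiemannianBundle (fun x : M ↦ TangentSpace (𝓡 (2 * n + 1)) x)]
    [IsContMDiffRiemannianBundle (𝓡 (2 * n + 1)) ∞ (EuclideanSpace ℝ (Fin (2 * n + 1)))
      (fun x : M ↦ TangentSpace (𝓡 (2 * n + 1)) x)]
    (cov : CovariantDerivative (𝓡 (2 * n + 1)) (EuclideanSpace ℝ (Fin (2 * n + 1)))
      (TangentSpace (𝓡 (2 * n + 1)) : M → Type _))
    [cov.ContMDiffCovariantDerivative ∞] (hcov : Kenmotsu.IsLeviCivita cov)
    (φ : Π x : M, TangentSpace (𝓡 (2 * n + 1)) x →L[ℝ] TangentSpace (𝓡 (2 * n + 1)) x)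
    (ξ : Π x : M, TangentSpace (𝓡 (2 * n + 1)) x)
    (η : Π x : M, TangentSpace (𝓡 (2 * n + 1)) x →L[ℝ] ℝ)
    (hK : Kenmotsu.IsKenmotsu cov φ ξ η)
    (V : Π x : M, TangentSpace (𝓡 (2 * n + 1)) x) (lam mu p : ℝ)
    (hsol : Kenmotsu.IsConformalEtaRicciSoliton cov η V lam mu p)
    (X : Π x : M, TangentSpace (𝓡 (2 * n + 1)) x) (hX : Kenmotsu.IsSmoothField X) (x : M) :
    Kenmotsu.lieConnection cov V X ξ x
      = (2 : ℝ) • Kenmotsu.ricciOperator cov x (X x) + (4 * (n : ℝ)) • X x := by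
  rw [hsol.lieConnection_ξ hcov hK hX x, finrank_euclideanSpace_fin]
  congr 2
  push_cast
  ring
end
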